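/- arXiv:2009.08888 — 2 statements merged into one kernel-verified Lean document; each statement's English description precedes it below -/
import Mathlib

section
/- For a cyclic Nakayama algebra Λ, the delooping level is bounded above by the φ-dimension: del Λ ≤ φdim Λ. -/
open Function DirectSum
open scoped Classical

noncomputable section

section Preamble

variable (A : Type) [Ring A]

/-- A submodule is small (superfluous) if it has no proper supplement. -/
def IsSmallSubmodule {M : Type} [AddCommGroup M] [Module A M] (N : Submodule A M) : Prop :=
  ∀ K : Submodule A M, N ⊔ K = ⊤ → K = ⊤

/-- `P` is a projective cover of `M`: `P` is projective, finitely generated, and there is a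
surjection `P → M` with small (superfluous) kernel. -/
def IsProjCoverOf (P M : ModuleCat.{0} A) : Prop :=
  Module.Projective A ↥P ∧ Module.Finite A ↥P ∧
    ∃ f : ↥P →ₗ[A] ↥M, Function.Surjective f ∧ IsSmallSubmodule A (LinearMap.ker f)

/-- `N` is (isomorphic to) the syzygy `Ω(M)`, i.e. the kernel of a projective cover of `M`. -/
def IsSyzygyOf (N M : ModuleCat.{0} A) : Prop :=
  ∃ (P : ModuleCat.{0} A) (f : ↥P →ₗ[A] ↥M),
    Module.Projective A ↥P ∧ Module.Finite A ↥P ∧ Function.Surjective f ∧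
      IsSmallSubmodule A (LinearMap.ker f) ∧ Nonempty (↥N ≃ₗ[A] ↥(LinearMap.ker f))

/-- `N` is (isomorphic to) the `n`-th syzygy `Ω^n(M)`. -/
def IsNthSyzygyOf : ℕ → ModuleCat.{0} A → ModuleCat.{0} A → Prop
  | 0 => fun N M => Nonempty (↥N ≃ₗ[A] ↥M)
  | n + 1 => fun N M => ∃ K : ModuleCat.{0} A, IsNthSyzygyOf n K M ∧ IsSyzygyOf A N K

/-- An indecomposable module: nontrivial, with no nontrivial direct sum decomposition. -/
def IndecomposableModule (M : ModuleCat.{0} A) : Prop :=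
  Nontrivial ↥M ∧ ∀ N N' : Submodule A ↥M, IsCompl N N' → N = ⊥ ∨ N = ⊤

/-- A uniserial module: the submodules form a chain. -/
def IsUniserialModule (M : ModuleCat.{0} A) : Prop :=
  ∀ N N' : Submodule A ↥M, N ≤ N' ∨ N' ≤ N

/-- A (one-sided) Nakayama condition: an Artinian ring all of whose finitely generated
indecomposable modules are uniserial. -/
def IsNakayamaRing : Prop :=
  IsArtinianRing A ∧
    ∀ M : ModuleCat.{0} A, Module.Finite A ↥M → IndecomposableModule A M → IsUniserialModule A M

/-- A Nakayama algebra: all indecomposable finitely generated (left and right) modules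
are uniserial. -/
def IsNakayamaAlgebra : Prop := IsNakayamaRing A ∧ IsNakayamaRing Aᵐᵒᵖ

/-- Connectedness: the only central idempotents are `0` and `1`. -/
def IsConnectedRing : Prop :=
  ∀ e : A, IsIdempotentElem e → e ∈ Set.center A → e = 0 ∨ e = 1

/-- A cyclic Nakayama algebra: a connected Nakayama algebra whose quiver is a cyclically
oriented cycle, equivalently with no simple projective module. -/
def IsCyclicNakayama : Prop :=
  IsNakayamaAlgebra A ∧ IsConnectedRing A ∧
    ∀ M : ModuleCat.{0} A, IsSimpleModule A ↥M → ¬ Module.Projective A ↥M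

/-- The projective dimension of a module, computed via minimal projective resolutions:
the least `n` such that `Ω^n(M)` is projective (`⊤ = ∞` if there is none). -/
def projDim (M : ModuleCat.{0} A) : ℕ∞ :=
  sInf ((fun n : ℕ => (n : ℕ∞)) ''
    {n : ℕ | ∃ N : ModuleCat.{0} A, IsNthSyzygyOf A n N M ∧ Module.Projective A ↥N})

/-- The finitistic dimension: the supremum of the (finite) projective dimensions of
finitely generated modules of finite projective dimension. -/
def finDim : ℕ∞ :=
  sSup {d : ℕ∞ | d ≠ ⊤ ∧ ∃ M : ModuleCat.{0} A, Module.Finite A ↥M ∧ projDim A M = d}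

/-- The global dimension: the supremum of the projective dimensions of all finitely
generated modules. -/
def globalDim : ℕ∞ :=
  sSup {d : ℕ∞ | ∃ M : ModuleCat.{0} A, Module.Finite A ↥M ∧ projDim A M = d}

/-- `N` is a direct summand of `M`. -/
def IsDirectSummandOf (N M : ModuleCat.{0} A) : Prop :=
  ∃ C : ModuleCat.{0} A, Nonempty (↥M ≃ₗ[A] (↥N × ↥C))

/-- The delooping level of a module `M`:
`del M = min { d | Ω^d(M) is a direct summand of A ⊕ Ω^{d+1}(M') for some f.g. M' }`. -/
def delMod (M : ModuleCat.{0} A) : ℕ∞ :=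
  sInf ((fun n : ℕ => (n : ℕ∞)) ''
    {d : ℕ | ∃ (M' N N' : ModuleCat.{0} A), Module.Finite A ↥M' ∧
      IsNthSyzygyOf A d N M ∧ IsNthSyzygyOf A (d + 1) N' M' ∧
      IsDirectSummandOf A N (ModuleCat.of A (A × ↥N'))})

/-- The delooping level of the algebra: the supremum over simple modules. -/
def delAlg : ℕ∞ :=
  sSup {d : ℕ∞ | ∃ S : ModuleCat.{0} A, IsSimpleModule A ↥S ∧ delMod A S = d}

/-- A periodic module: `Ω^t(M) ≅ M` for some `t ≥ 1`. -/
def IsPeriodicModule (M : ModuleCat.{0} A) : Prop :=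
  ∃ t : ℕ, 1 ≤ t ∧ IsNthSyzygyOf A t M M

/-- Selfinjectivity: the regular module is injective. -/
def IsSelfinjectiveRing : Prop := Module.Injective A A

/-- The socle of a module: the sum of all simple submodules. -/
def socleOf (M : ModuleCat.{0} A) : Submodule A ↥M :=
  sSup {N : Submodule A ↥M | IsSimpleModule A ↥N}

/-- The radical of a module: `rad M = J(A)·M`. -/
def radOf (M : Type) [AddCommGroup M] [Module A M] : Submodule A M :=
  (Ideal.jacobson (⊥ : Ideal A)) • (⊤ : Submodule A M)

/-- The top of a module: `M / rad M`. -/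
abbrev topOf (M : Type) [AddCommGroup M] [Module A M] :=
  M ⧸ radOf A M

end Preamble

section Phi

variable (A : Type) [Ring A]

/-- Finitely generated indecomposable modules. -/
def FGIndec := {M : ModuleCat.{0} A // Module.Finite A ↥M ∧ IndecomposableModule A M}

/-- Isomorphism as a setoid on finitely generated indecomposable modules. -/
def indecSetoid : Setoid (FGIndec A) where
  r X Y := Nonempty (↥X.1 ≃ₗ[A] ↥Y.1)
  iseqv := ⟨fun _ => ⟨LinearEquiv.refl A _⟩,
            fun h => h.elim fun e => ⟨e.symm⟩,
            fun h h' => h.elim fun e => h'.elim fun e' => ⟨e.trans e'⟩⟩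

/-- Isomorphism classes of finitely generated indecomposable modules. -/
abbrev IndecIso := Quotient (indecSetoid A)

/-- The free abelian group on iso-classes of f.g. indecomposable modules. -/
abbrev K0Group := IndecIso A →₀ ℤ

/-- `f` records a decomposition of `M` as a direct sum of indecomposables with
multiplicities. -/
def IsDecompositionOf (f : IndecIso A →₀ ℕ) (M : ModuleCat.{0} A) : Prop :=
  Nonempty (↥M ≃ₗ[A] DirectSum (Σ x : f.support, Fin (f x.1))
    (fun i => ↥((Quotient.out i.1.1).1)))

/-- The class of `M` in the free abelian group on indecomposables (junk value `0` if no
decomposition exists). -/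
def decompClass (M : ModuleCat.{0} A) : K0Group A :=
  if h : ∃ f : IndecIso A →₀ ℕ, IsDecompositionOf A f M
  then (Classical.choose h).mapRange (fun m : ℕ => (m : ℤ)) (by simp)
  else 0

/-- A choice of syzygy module `Ω(M)` (junk value `0` if no projective cover exists). -/
def syzygyModule (M : ModuleCat.{0} A) : ModuleCat.{0} A :=
  if h : ∃ N : ModuleCat.{0} A, IsSyzygyOf A N M then Classical.choose h
  else ModuleCat.of A PUnit

/-- The Igusa–Todorov endomorphism `L` of the free abelian group on indecomposables,
sending `[M] ↦ [Ω M]`. -/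
def syzygyEnd : AddMonoid.End (K0Group A) :=
  Finsupp.liftAddHom fun x : IndecIso A =>
    (zmultiplesHom (K0Group A)) (decompClass A (syzygyModule A (Quotient.out x).1))

/-- The generators `[X]`, `X` an indecomposable direct summand of `M`, of the subgroup
`⟨add M⟩`. -/
def addGenerators (M : ModuleCat.{0} A) : Set (K0Group A) :=
  {g | ∃ (X : ModuleCat.{0} A) (h : Module.Finite A ↥X ∧ IndecomposableModule A X),
      IsDirectSummandOf A X M ∧ g = Finsupp.single (Quotient.mk (indecSetoid A) ⟨X, h⟩) 1}

/-- The Igusa–Todorov function `φ(M)`: the least `t` at which the rank of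
`L^t⟨add M⟩` stabilizes. -/
def phiMod (M : ModuleCat.{0} A) : ℕ∞ :=
  sInf ((fun n : ℕ => (n : ℕ∞)) ''
    {t : ℕ | ∀ j : ℕ, 1 ≤ j →
      Module.finrank ℤ
        ↥(AddSubgroup.map ((syzygyEnd A) ^ t) (AddSubgroup.closure (addGenerators A M))) =
      Module.finrank ℤ
        ↥(AddSubgroup.map ((syzygyEnd A) ^ (t + j)) (AddSubgroup.closure (addGenerators A M)))})

/-- The `φ`-dimension of the algebra. -/
def phiDim : ℕ∞ :=
  sSup {d : ℕ∞ | ∃ M : ModuleCat.{0} A, Module.Finite A ↥M ∧ phiMod A M = d}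

end Phi

section Epsilon

variable (A : Type) [Ring A]

/-- `T` is (isomorphic to) the socle of some indecomposable projective module. -/
def IsSocleOfIndecProjective (T : ModuleCat.{0} A) : Prop :=
  IsSimpleModule A ↥T ∧ ∃ Q : ModuleCat.{0} A, Module.Projective A ↥Q ∧ Module.Finite A ↥Q ∧
    IndecomposableModule A Q ∧ Nonempty (↥T ≃ₗ[A] ↥(socleOf A Q))

/-- `S` belongs to `S'(Λ)`: `S ≅ S_{i+1}` where `S_i` is a socle of an indecomposable
projective; here `S_{i+1} = top (rad P(S_i))` for the cyclic quiver. -/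
def IsInSPrime (S : ModuleCat.{0} A) : Prop :=
  IsSimpleModule A ↥S ∧ ∃ T P : ModuleCat.{0} A, IsSocleOfIndecProjective A T ∧
    IsProjCoverOf A P T ∧ Nonempty ((topOf A ↥(radOf A ↥P)) ≃ₗ[A] ↥S)

/-- `B` is (isomorphic to) the syzygy filtered algebra
`ε(Λ) = End_Λ(⊕_{S ∈ S'(Λ)} P(S))`. -/
def IsSyzygyFilteredAlgebra (B : Type) [Ring B] : Prop :=
  ∃ (ι : Type) (_ : Fintype ι) (Sf Pf : ι → ModuleCat.{0} A),
    (∀ i, IsInSPrime A (Sf i) ∧ IsProjCoverOf A (Pf i) (Sf i)) ∧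
    (∀ i j, Nonempty (↥(Sf i) ≃ₗ[A] ↥(Sf j)) → i = j) ∧
    (∀ S : ModuleCat.{0} A, IsInSPrime A S → ∃ i, Nonempty (↥S ≃ₗ[A] ↥(Sf i))) ∧
    Nonempty (B ≃+* Module.End A (DirectSum ι fun i => ↥(Pf i)))

/-- `B` is (isomorphic to) the `d`-th iterated syzygy filtered algebra `ε^d(Λ)`,
each intermediate step being a cyclic non-selfinjective Nakayama algebra. -/
def IsIterSyzygyFiltered (d : ℕ) (B : Type) [Ring B] : Prop :=
  ∃ C : ℕ → RingCat.{0},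
    Nonempty (A ≃+* ↥(C 0)) ∧ Nonempty (↥(C d) ≃+* B) ∧
    ∀ i < d, IsCyclicNakayama ↥(C i) ∧ ¬ IsSelfinjectiveRing ↥(C i) ∧
      IsSyzygyFilteredAlgebra ↥(C i) ↥(C (i + 1))

end Epsilon


section SyzygyLemmas

variable {A : Type} [Ring A]

theorem IsUniserialModule.indecomposable {M : ModuleCat.{0} A} [Nontrivial M]
    (hM : IsUniserialModule A M) : IndecomposableModule A M := by
  refine ⟨inferInstance, fun N N' h => ?_⟩
  rcases hM N N' with h' | h'
  · exact Or.inl (h.disjoint.eq_bot_of_le h')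
  · exact Or.inr (by simpa [sup_eq_left.mpr h'] using h.sup_eq_top)

theorem IsUniserialModule.eq_top_or_eq_top {M : ModuleCat.{0} A} (hM : IsUniserialModule A M)
    {N N' : Submodule A M} (h : N ⊔ N' = ⊤) : N = ⊤ ∨ N' = ⊤ := by
  rcases hM N N' with h' | h'
  · exact Or.inr (by rwa [sup_eq_right.mpr h'] at h)
  · exact Or.inl (by rwa [sup_eq_left.mpr h'] at h)

theorem IsUniserialModule.submodule {M : ModuleCat.{0} A} (hM : IsUniserialModule A M)
    (N : Submodule A M) : IsUniserialModule A (ModuleCat.of A N) := by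
  intro K K'
  rcases hM (K.map N.subtype) (K'.map N.subtype) with h | h
  · exact Or.inl ((Submodule.map_le_map_iff_of_injective N.injective_subtype _ _).mp h)
  · exact Or.inr ((Submodule.map_le_map_iff_of_injective N.injective_subtype _ _).mp h)

theorem IsUniserialModule.of_equiv {M N : ModuleCat.{0} A} (hM : IsUniserialModule A M)
    (e : N ≃ₗ[A] M) : IsUniserialModule A N := by
  intro K K'
  rcases hM (K.map e.toLinearMap) (K'.map e.toLinearMap) with h | h
  · exact Or.inl ((Submodule.map_le_map_iff_of_injective e.injective _ _).mp h)
  · exact Or.inr ((Submodule.map_le_map_iff_of_injective e.injective _ _).mp h)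

theorem IsUniserialModule.finite_submodule {M : ModuleCat.{0} A} [IsNoetherian A M]
    [IsArtinian A M] (hM : IsUniserialModule A M) : Finite (Submodule A M) := by
  have : Std.Total (α := Submodule A M) (· ≤ ·) := ⟨hM⟩
  let _ : LinearOrder (Submodule A M) := Lattice.toLinearOrder _
  have : WellFoundedLT (Submodule A M) := inferInstanceAs (IsArtinian A M)
  have : WellFoundedGT (Submodule A M) := inferInstance
  exact Finite.of_wellFoundedLT_wellFoundedGT _

/-- A complemented submodule of an Artinian module is a finite sum of indecomposable complemented
submodules. -/
theorem exists_finset_indecomposable_sup_eq {M : Type} [AddCommGroup M] [Module A M]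
    [IsArtinian A M] (P : Submodule A M) (hP : IsComplemented P) :
    ∃ F : Finset (Submodule A M),
      (∀ Q ∈ F, IsComplemented Q ∧ IndecomposableModule A (ModuleCat.of A Q)) ∧
        F.sup id = P := by
  induction P using WellFoundedLT.induction with
  | ind P ih =>
  by_cases hbot : P = ⊥
  · exact ⟨∅, by simp, by simp [hbot]⟩
  by_cases hind : IndecomposableModule A (ModuleCat.of A P)
  · exact ⟨{P}, by simp [hP, hind], by simp⟩
  have hnt : Nontrivial P := Submodule.nontrivial_iff_ne_bot.mpr hbot
  simp only [IndecomposableModule, not_and, not_forall, not_or] at hind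
  obtain ⟨N, N', hc, hN, hN'⟩ := hind hnt
  have hN'top : N' ≠ ⊤ := fun h => hN (by simpa [h] using hc.disjoint)
  have hlt (K : Submodule A P) (hK : K ≠ ⊤) : K.map P.subtype < P := by
    refine lt_of_le_of_ne (Submodule.map_subtype_le P K) fun h => hK ?_
    exact Submodule.map_injective_of_injective P.injective_subtype
      (h.trans (Submodule.map_subtype_top P).symm)
  have hsup : N.map P.subtype ⊔ N'.map P.subtype = P := by
    rw [← Submodule.map_sup, hc.sup_eq_top, Submodule.map_subtype_top]
  have hdisj : Disjoint (N.map P.subtype) (N'.map P.subtype) :=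
    (Submodule.disjoint_map P.injective_subtype) hc.disjoint
  obtain ⟨Q, hQ⟩ := hP
  have hcN : IsComplemented (N.map P.subtype) := by
    refine ⟨N'.map P.subtype ⊔ Q, ?_, ?_⟩
    · exact hdisj.disjoint_sup_right_of_disjoint_sup_left (by rw [hsup]; exact hQ.disjoint)
    · rw [codisjoint_iff, ← sup_assoc, hsup, hQ.sup_eq_top]
  have hcN' : IsComplemented (N'.map P.subtype) := by
    rw [sup_comm] at hsup
    refine ⟨N.map P.subtype ⊔ Q, ?_, ?_⟩
    · exact hdisj.symm.disjoint_sup_right_of_disjoint_sup_left (by rw [hsup]; exact hQ.disjoint)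
    · rw [codisjoint_iff, ← sup_assoc, hsup, hQ.sup_eq_top]
  obtain ⟨F, hF, hFs⟩ := ih _ (hlt N hN') hcN
  obtain ⟨F', hF', hFs'⟩ := ih _ (hlt N' hN'top) hcN'
  refine ⟨F ∪ F', fun Q hQ => ?_, by rw [Finset.sup_union, hFs, hFs', hsup]⟩
  rcases Finset.mem_union.mp hQ with h | h
  exacts [hF Q h, hF' Q h]

/-- A projective cover of an indecomposable module over a Nakayama ring is uniserial. -/
theorem IsNakayamaRing.isUniserialModule_of_small_ker (hA : IsNakayamaRing A)
    {X P : ModuleCat.{0} A} (hX : Module.Finite A X ∧ IndecomposableModule A X)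
    (hP : Module.Finite A P) (f : P →ₗ[A] X) (hf : Function.Surjective f)
    (hs : IsSmallSubmodule A (LinearMap.ker f)) : IsUniserialModule A P := by
  have hXu := hA.2 X hX.1 hX.2
  have := hX.2.1
  refine hA.2 P hP ⟨hf.nontrivial, fun N N' h => ?_⟩
  have key (K : Submodule A P) (hK : K.map f = ⊤) : K = ⊤ := by
    refine hs K (eq_top_iff.mpr fun x _ => ?_)
    obtain ⟨k, hk, hkx⟩ : f x ∈ K.map f := hK ▸ Submodule.mem_top
    refine Submodule.mem_sup.mpr ⟨x - k, ?_, k, hk, by simp⟩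
    simp [hkx]
  have hmap : N.map f ⊔ N'.map f = ⊤ := by
    rw [← Submodule.map_sup, h.sup_eq_top, Submodule.map_top, LinearMap.range_eq_top.mpr hf]
  rcases hXu.eq_top_or_eq_top hmap with h' | h'
  · exact Or.inr (key N h')
  · exact Or.inl (by simpa [key N' h'] using h.disjoint)

theorem IsUniserialModule.exists_span_singleton_eq_top {X : ModuleCat.{0} A} [Module.Finite A X]
    (hX : IsUniserialModule A X) : ∃ x : X, Submodule.span A {x} = ⊤ := by
  obtain ⟨s, hs⟩ := Module.Finite.fg_top (R := A) (M := X)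
  rw [← hs]
  clear hs
  induction s using Finset.induction_on with
  | empty => exact ⟨0, by simp⟩
  | insert a s _ ih =>
    obtain ⟨x, hx⟩ := ih
    rw [Finset.coe_insert, Submodule.span_insert, ← hx]
    rcases hX (Submodule.span A {a}) (Submodule.span A {x}) with h | h
    · exact ⟨x, (sup_eq_right.mpr h).symm⟩
    · exact ⟨a, (sup_eq_left.mpr h).symm⟩

/-- If finitely many submodules of the regular module generate it, one of them surjects onto any
given nonzero finitely generated uniserial module. -/
theorem IsUniserialModule.exists_surjective_of_sup_eq_top {X : ModuleCat.{0} A}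
    [Module.Finite A X] [Nontrivial X] (hX : IsUniserialModule A X)
    (F : Finset (Submodule A A)) (hF : F.sup id = ⊤) :
    ∃ P ∈ F, ∃ f : P →ₗ[A] X, Function.Surjective f := by
  obtain ⟨x, hx⟩ := hX.exists_span_singleton_eq_top
  let g : A →ₗ[A] X := LinearMap.toSpanSingleton A X x
  have hg : (⊤ : Submodule A A).map g = ⊤ := by
    rw [Submodule.map_top, ← hx]; exact (LinearMap.range_toSpanSingleton x)
  have key (G : Finset (Submodule A A)) (hG : (G.sup id).map g = ⊤) :
      ∃ P ∈ G, P.map g = ⊤ := by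
    induction G using Finset.induction_on with
    | empty => exact absurd hG (by simp [bot_ne_top])
    | insert P G _ ih =>
      rw [Finset.sup_insert, Submodule.map_sup] at hG
      rcases hX.eq_top_or_eq_top hG with h | h
      · exact ⟨P, by simp, h⟩
      · obtain ⟨Q, hQ, hQ'⟩ := ih h
        exact ⟨Q, by simp [hQ], hQ'⟩
  obtain ⟨P, hP, hPt⟩ := key F (hF ▸ hg)
  refine ⟨P, hP, g.comp P.subtype, ?_⟩
  rw [← LinearMap.range_eq_top, LinearMap.range_comp, Submodule.range_subtype, hPt]

theorem Submodule.projective_of_isComplemented {M : Type} [AddCommGroup M] [Module A M]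
    [Module.Projective A M] {P : Submodule A M} (hP : IsComplemented P) :
    Module.Projective A P := by
  obtain ⟨Q, hQ⟩ := hP
  exact Module.Projective.of_split P.subtype (P.projectionOnto Q hQ) (by ext; simp)

/-- Over a Nakayama ring there are finitely many projective modules covering every finitely
generated indecomposable module. -/
theorem IsNakayamaRing.exists_finset_surjective (hA : IsNakayamaRing A) :
    ∃ F : Finset (Submodule A A),
      (∀ P ∈ F, Module.Projective A P ∧ IsUniserialModule A (ModuleCat.of A P)) ∧
      ∀ X : ModuleCat.{0} A, Module.Finite A X → IndecomposableModule A X →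
        ∃ P ∈ F, ∃ f : P →ₗ[A] X, Function.Surjective f := by
  have := hA.1
  obtain ⟨F, hF, hFs⟩ := exists_finset_indecomposable_sup_eq (⊤ : Submodule A A) isComplemented_top
  refine ⟨F, fun P hP => ⟨Submodule.projective_of_isComplemented (hF P hP).1,
    hA.2 _ (inferInstanceAs (Module.Finite A P)) (hF P hP).2⟩, fun X hX hXi => ?_⟩
  have := hXi.1
  exact (hA.2 X hX hXi).exists_surjective_of_sup_eq_top F hFs

theorem IsNakayamaRing.finite_indecIso (hA : IsNakayamaRing A) : Finite (IndecIso A) := by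
  have := hA.1
  obtain ⟨F, hF, hFX⟩ := hA.exists_finset_surjective
  have hfin (P : F) : Finite (Submodule A P.1) := by
    have : IsNoetherian A (ModuleCat.of A P.1) := inferInstanceAs (IsNoetherian A P.1)
    have : IsArtinian A (ModuleCat.of A P.1) := inferInstanceAs (IsArtinian A P.1)
    exact (hF P.1 P.2).2.finite_submodule
  choose! P hP f hf using fun x : IndecIso A => hFX x.out.1 x.out.2.1 x.out.2.2
  let code (x : IndecIso A) : Σ P : F, Submodule A P.1 := ⟨⟨P x, hP x⟩, LinearMap.ker (f x)⟩
  refine Finite.of_injective code fun x y hxy => ?_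
  rw [← Quotient.out_equiv_out]
  have equivOf (c : Σ P : F, Submodule A P.1) (z : IndecIso A) (hz : code z = c) :
      Nonempty ((c.1.1 ⧸ c.2) ≃ₗ[A] z.out.1) := by
    subst hz
    exact ⟨(f z).quotKerEquivOfSurjective (hf z)⟩
  obtain ⟨ex⟩ := equivOf _ x rfl
  obtain ⟨ey⟩ := equivOf _ y hxy.symm
  exact ⟨ex.symm.trans ey⟩

theorem IsNakayamaRing.exists_isSyzygyOf (hA : IsNakayamaRing A) {X : ModuleCat.{0} A}
    (hX : Module.Finite A X ∧ IndecomposableModule A X) : ∃ N, IsSyzygyOf A N X := by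
  have := hA.1
  have := hX.2.1
  obtain ⟨F, hF, hFX⟩ := hA.exists_finset_surjective
  obtain ⟨P, hP, f, hf⟩ := hFX X hX.1 hX.2
  refine ⟨ModuleCat.of A (LinearMap.ker f), ModuleCat.of A P, f, (hF P hP).1,
    inferInstanceAs (Module.Finite A P), hf, fun K hK => ?_, ⟨LinearEquiv.refl A _⟩⟩
  refine ((hF P hP).2.eq_top_or_eq_top hK).resolve_left fun h => ?_
  obtain ⟨x, hx⟩ := exists_ne (0 : X)
  obtain ⟨p, rfl⟩ := hf x
  exact hx (LinearMap.mem_ker.mp (h ▸ Submodule.mem_top))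

theorem IsNakayamaRing.isSyzygyOf_syzygyModule (hA : IsNakayamaRing A) {X : ModuleCat.{0} A}
    (hX : Module.Finite A X ∧ IndecomposableModule A X) :
    IsSyzygyOf A (syzygyModule A X) X := by
  have h := hA.exists_isSyzygyOf hX
  rw [syzygyModule, dif_pos h]
  exact Classical.choose_spec h

/-- Over a Nakayama ring, syzygies of indecomposable modules are zero or indecomposable. -/
theorem IsNakayamaRing.subsingleton_or_indecomposable_of_isSyzygyOf (hA : IsNakayamaRing A)
    {N X : ModuleCat.{0} A} (hX : Module.Finite A X ∧ IndecomposableModule A X)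
    (hN : IsSyzygyOf A N X) :
    Subsingleton N ∨ (Module.Finite A N ∧ IndecomposableModule A N) := by
  have := hA.1
  obtain ⟨P, f, -, hP, hf, hs, ⟨e⟩⟩ := hN
  have hPu := hA.isUniserialModule_of_small_ker hX hP f hf hs
  rcases subsingleton_or_nontrivial N with h | h
  · exact Or.inl h
  · exact Or.inr ⟨Module.Finite.equiv e.symm,
      ((hPu.submodule (LinearMap.ker f)).of_equiv (N := N) e).indecomposable⟩

theorem indecomposableModule_of_isSimpleModule {S : ModuleCat.{0} A} (hS : IsSimpleModule A S) :
    Module.Finite A S ∧ IndecomposableModule A S :=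
  ⟨inferInstance, IsSimpleModule.nontrivial A S, fun N _ _ => eq_bot_or_eq_top N⟩

theorem LinearMap.isCompl_range_ker_of_leftInverse {M N : Type} [AddCommGroup M] [Module A M]
    [AddCommGroup N] [Module A N] {σ : N →ₗ[A] M} {π : M →ₗ[A] N}
    (h : Function.LeftInverse π σ) : IsCompl (LinearMap.range σ) (LinearMap.ker π) := by
  constructor
  · rw [Submodule.disjoint_def]
    rintro _ ⟨x, rfl⟩ hx
    rw [LinearMap.mem_ker, h x] at hx
    rw [hx, map_zero]
  · rw [codisjoint_iff, eq_top_iff]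
    intro m _
    refine Submodule.mem_sup.mpr ⟨σ (π m), LinearMap.mem_range_self _ _, m - σ (π m), ?_, by simp⟩
    simp [h (π m)]

theorem isDirectSummandOf_of_leftInverse {M N : ModuleCat.{0} A} {σ : N →ₗ[A] M} {π : M →ₗ[A] N}
    (h : Function.LeftInverse π σ) : IsDirectSummandOf A N M :=
  ⟨ModuleCat.of A (LinearMap.ker π),
    ⟨((LinearEquiv.ofInjective σ h.injective).prodCongr (LinearEquiv.refl A _) |>.trans
      (Submodule.prodEquivOfIsCompl _ _
        (LinearMap.isCompl_range_ker_of_leftInverse h))).symm⟩⟩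

/-- A direct sum over a subsingleton index type is isomorphic to any of its summands. -/
def DirectSum.lequivOfSubsingleton {ι : Type*} [DecidableEq ι] [Subsingleton ι] (X : ι → Type)
    [∀ i, AddCommGroup (X i)] [∀ i, Module A (X i)] (i : ι) : X i ≃ₗ[A] DirectSum ι X :=
  LinearEquiv.ofLinearMap (DirectSum.lof A ι X i) (DirectSum.component A ι X i)
    (by
      refine DirectSum.linearMap_ext A fun j => LinearMap.ext fun x => ?_
      obtain rfl := Subsingleton.elim i j
      simp [DirectSum.component.lof_self])
    (DirectSum.component_comp_lof_same A i)

/-- An indecomposable direct sum of nonzero modules has at most one summand. -/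
theorem IndecomposableModule.subsingleton_index {ι : Type*} [DecidableEq ι] {M : ModuleCat.{0} A}
    (hM : IndecomposableModule A M) (X : ι → Type) [∀ i, AddCommGroup (X i)]
    [∀ i, Module A (X i)] [∀ i, Nontrivial (X i)] (e : M ≃ₗ[A] DirectSum ι X) :
    Subsingleton ι := by
  refine ⟨fun i j => by_contra fun hij => ?_⟩
  let π : M →ₗ[A] X i := (DirectSum.component A ι X i).comp e.toLinearMap
  let σ : X i →ₗ[A] M := e.symm.toLinearMap.comp (DirectSum.lof A ι X i)
  have hπσ (x : X i) : π (σ x) = x := by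
    simp [π, σ, DirectSum.component.lof_self]
  have hc : IsCompl (LinearMap.range σ) (LinearMap.ker π) :=
    LinearMap.isCompl_range_ker_of_leftInverse hπσ
  obtain ⟨x, hx⟩ := exists_ne (0 : X i)
  obtain ⟨y, hy⟩ := exists_ne (0 : X j)
  rcases hM.2 _ _ hc with h | h
  · have : σ x = 0 := by
      rw [← Submodule.mem_bot A, ← h]; exact LinearMap.mem_range_self σ x
    exact hx (by rw [← hπσ x, this, map_zero])
  · have hker : LinearMap.ker π = ⊥ := by simpa [h] using hc.disjoint
    have hmem : e.symm (DirectSum.lof A ι X j y) ∈ LinearMap.ker π := by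
      simp [π, DirectSum.component.of, Ne.symm hij]
    rw [hker, Submodule.mem_bot, e.symm.map_eq_zero_iff] at hmem
    apply hy
    have := congrArg (DirectSum.component A ι X j) hmem
    simpa [DirectSum.component.lof_self] using this

theorem nontrivial_out (x : IndecIso A) : Nontrivial x.out.1 := x.out.2.2.1

theorem isDecompositionOf_single {M : ModuleCat.{0} A}
    (hM : Module.Finite A M ∧ IndecomposableModule A M) :
    IsDecompositionOf A (Finsupp.single (Quotient.mk (indecSetoid A) ⟨M, hM⟩) 1) M := by
  set x : IndecIso A := Quotient.mk (indecSetoid A) ⟨M, hM⟩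
  obtain ⟨e⟩ : Nonempty (x.out.1 ≃ₗ[A] M) := Quotient.mk_out (s := indecSetoid A) ⟨M, hM⟩
  have hsupp : x ∈ (Finsupp.single x 1 : IndecIso A →₀ ℕ).support := by simp
  let i₀ : Σ y : (Finsupp.single x 1 : IndecIso A →₀ ℕ).support,
    Fin ((Finsupp.single x 1 : IndecIso A →₀ ℕ) y.1) := ⟨⟨x, hsupp⟩, ⟨0, by simp⟩⟩
  have huniq : ∀ i, i = i₀ := by
    rintro ⟨⟨y, hy⟩, k, hk⟩
    obtain rfl : y = x := by
      by_contra h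
      exact Finsupp.mem_support_iff.mp hy (Finsupp.single_eq_of_ne h)
    simp only [Finsupp.single_eq_same, Nat.lt_one_iff] at hk
    subst hk
    rfl
  have : Subsingleton (Σ y : (Finsupp.single x 1 : IndecIso A →₀ ℕ).support,
    Fin ((Finsupp.single x 1 : IndecIso A →₀ ℕ) y.1)) :=
    ⟨fun i j => (huniq i).trans (huniq j).symm⟩
  exact ⟨e.symm.trans (DirectSum.lequivOfSubsingleton
    (fun i : Σ y : (Finsupp.single x 1 : IndecIso A →₀ ℕ).support,
      Fin ((Finsupp.single x 1 : IndecIso A →₀ ℕ) y.1) => i.1.1.out.1) i₀)⟩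

theorem decompClass_of_indecomposable {M : ModuleCat.{0} A}
    (hM : Module.Finite A M ∧ IndecomposableModule A M) :
    decompClass A M = Finsupp.single (Quotient.mk (indecSetoid A) ⟨M, hM⟩) 1 := by
  have h : ∃ f : IndecIso A →₀ ℕ, IsDecompositionOf A f M := ⟨_, isDecompositionOf_single hM⟩
  rw [decompClass, dif_pos h]
  obtain ⟨e⟩ := Classical.choose_spec h
  generalize Classical.choose h = f at e
  have := fun i : (Σ x : f.support, Fin (f x.1)) => nontrivial_out i.1.1
  have hsub := hM.2.subsingleton_index _ e
  have := hM.2.1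
  obtain ⟨i⟩ : Nonempty (Σ x : f.support, Fin (f x.1)) := by
    by_contra hne
    rw [not_nonempty_iff] at hne
    exact not_subsingleton M e.toEquiv.subsingleton
  have hx : i.1.1 = Quotient.mk (indecSetoid A) ⟨M, hM⟩ := by
    rw [← Quotient.out_eq i.1.1]
    exact Quotient.sound ⟨(DirectSum.lequivOfSubsingleton
      (fun i : Σ x : f.support, Fin (f x.1) => i.1.1.out.1) i).trans e.symm⟩
  have hone : f i.1.1 = 1 := by
    have : Subsingleton (Fin (f i.1.1)) :=
      ⟨fun a b => by simpa using hsub.elim ⟨i.1, a⟩ ⟨i.1, b⟩⟩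
    have h1 := Fin.subsingleton_iff_le_one.mp this
    have h2 := i.2.pos
    omega
  have hf : f = Finsupp.single i.1.1 1 := by
    ext y
    by_cases hy : y = i.1.1
    · subst hy; simp [hone]
    · rw [Finsupp.single_apply, if_neg (Ne.symm hy)]
      by_contra hne
      have := hsub.elim ⟨⟨y, Finsupp.mem_support_iff.mpr hne⟩, ⟨0, Nat.pos_of_ne_zero hne⟩⟩ i
      exact hy (congrArg (fun j => j.1.1) this)
  rw [hf, Finsupp.mapRange_single, hx, Nat.cast_one]

theorem decompClass_of_subsingleton {M : ModuleCat.{0} A} [Subsingleton M] :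
    decompClass A M = 0 := by
  by_cases h : ∃ f : IndecIso A →₀ ℕ, IsDecompositionOf A f M
  · rw [decompClass, dif_pos h]
    obtain ⟨e⟩ := Classical.choose_spec h
    generalize Classical.choose h = f at e
    suffices f = 0 by rw [this, Finsupp.mapRange_zero]
    ext y
    by_contra hne
    let i : Σ x : f.support, Fin (f x.1) :=
      ⟨⟨y, Finsupp.mem_support_iff.mpr hne⟩, ⟨0, Nat.pos_of_ne_zero hne⟩⟩
    have := nontrivial_out y
    obtain ⟨z, hz⟩ := exists_ne (0 : y.out.1)
    have := e.symm.toEquiv.subsingleton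
    have h0 := Subsingleton.elim (DirectSum.lof A (Σ x : f.support, Fin (f x.1))
      (fun i => ↥((Quotient.out i.1.1).1)) i z) 0
    have := congrArg (DirectSum.component A _ _ i) h0
    rw [DirectSum.component.lof_self, map_zero] at this
    exact hz this
  · rw [decompClass, dif_neg h]

theorem syzygyEnd_single (x : IndecIso A) :
    syzygyEnd A (Finsupp.single x 1) = decompClass A (syzygyModule A x.out.1) :=
  (Finsupp.liftAddHom_apply_single _ _ _).trans (one_zsmul _)

theorem IsSyzygyOf.of_equiv {N X Y : ModuleCat.{0} A} (h : IsSyzygyOf A N X) (e : X ≃ₗ[A] Y) :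
    IsSyzygyOf A N Y := by
  obtain ⟨P, f, hP, hPf, hf, hs, ⟨g⟩⟩ := h
  have hker : LinearMap.ker (e.toLinearMap.comp f) = LinearMap.ker f := by
    simp [LinearMap.ker_comp]
  exact ⟨P, e.toLinearMap.comp f, hP, hPf, e.surjective.comp hf, hker ▸ hs,
    ⟨g.trans (LinearEquiv.ofEq _ _ hker.symm)⟩⟩

theorem isSyzygyOf_self_of_subsingleton {X : ModuleCat.{0} A} [Subsingleton X] :
    IsSyzygyOf A X X := by
  refine ⟨X, LinearMap.id, Module.Projective.of_free, inferInstance, Function.surjective_id,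
    fun K _ => Subsingleton.elim _ _, ⟨LinearEquiv.ofSubsingleton X _⟩⟩

/-- The iterates of the Igusa–Todorov endomorphism compute the classes of iterated syzygies of
indecomposable modules. -/
theorem IsNakayamaRing.exists_isNthSyzygyOf (hA : IsNakayamaRing A) (X : FGIndec A) (t : ℕ) :
    ∃ N : ModuleCat.{0} A, IsNthSyzygyOf A t N X.1 ∧
      ((Subsingleton N ∧
          (syzygyEnd A ^ t) (Finsupp.single (Quotient.mk (indecSetoid A) X) 1) = 0) ∨
        ∃ hN : Module.Finite A N ∧ IndecomposableModule A N,
          (syzygyEnd A ^ t) (Finsupp.single (Quotient.mk (indecSetoid A) X) 1) =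
            Finsupp.single (Quotient.mk (indecSetoid A) ⟨N, hN⟩) 1) := by
  induction t with
  | zero => exact ⟨X.1, ⟨LinearEquiv.refl A _⟩, Or.inr ⟨X.2, rfl⟩⟩
  | succ t ih =>
    obtain ⟨N, hN, ⟨hsub, h0⟩ | ⟨hind, h1⟩⟩ := ih
    · refine ⟨N, ⟨N, hN, isSyzygyOf_self_of_subsingleton⟩, Or.inl ⟨hsub, ?_⟩⟩
      rw [pow_succ', AddMonoid.End.coe_mul, Function.comp_apply, h0, map_zero]
    · let y : IndecIso A := Quotient.mk (indecSetoid A) ⟨N, hind⟩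
      obtain ⟨e⟩ : Nonempty (y.out.1 ≃ₗ[A] N) := Quotient.mk_out (s := indecSetoid A) ⟨N, hind⟩
      have hsyz := hA.isSyzygyOf_syzygyModule y.out.2
      refine ⟨syzygyModule A y.out.1, ⟨N, hN, hsyz.of_equiv e⟩, ?_⟩
      rw [pow_succ', AddMonoid.End.coe_mul, Function.comp_apply, h1, syzygyEnd_single]
      rcases hA.subsingleton_or_indecomposable_of_isSyzygyOf y.out.2 hsyz with h | h
      · exact Or.inl ⟨h, decompClass_of_subsingleton⟩
      · exact Or.inr ⟨h, decompClass_of_indecomposable h⟩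

/-- If an endomorphism of a free abelian group of finite rank sends basis vectors to basis vectors
or zero, then as soon as the rank of the image of a power stabilizes, every basis vector in that
image comes from a basis vector under the next power. -/
theorem exists_pow_succ_single_eq_of_finrank_range_eq {ι : Type*} [Finite ι]
    (L : AddMonoid.End (ι →₀ ℤ))
    (hL : ∀ x, L (Finsupp.single x 1) = 0 ∨ ∃ y, L (Finsupp.single x 1) = Finsupp.single y 1)
    (t : ℕ)
    (hrank : Module.finrank ℤ (AddSubgroup.map (L ^ t) ⊤) =
      Module.finrank ℤ (AddSubgroup.map (L ^ (t + 1)) ⊤))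
    {x y : ι} (hxy : (L ^ t) (Finsupp.single x 1) = Finsupp.single y 1) :
    ∃ z, (L ^ (t + 1)) (Finsupp.single z 1) = Finsupp.single y 1 := by
  let I (n : ℕ) : Set ι := {y | ∃ x, (L ^ n) (Finsupp.single x 1) = Finsupp.single y 1}
  have hpow (n : ℕ) (x : ι) : (L ^ n) (Finsupp.single x 1) = 0 ∨
      ∃ y, (L ^ n) (Finsupp.single x 1) = Finsupp.single y 1 := by
    induction n with
    | zero => exact Or.inr ⟨x, by simp⟩
    | succ n ih =>
      rw [pow_succ', AddMonoid.End.coe_mul, Function.comp_apply]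
      rcases ih with h | ⟨y, h⟩
      · exact Or.inl (by rw [h, map_zero])
      · rw [h]; exact hL y
  have hmap (n : ℕ) : AddSubgroup.map (L ^ n) ⊤ =
      (Finsupp.supported ℤ ℤ (I n)).toAddSubgroup := by
    apply le_antisymm
    · rintro _ ⟨v, -, rfl⟩
      change (L ^ n) v ∈ Finsupp.supported ℤ ℤ (I n)
      induction v using Finsupp.induction_linear with
      | zero => rw [map_zero]; exact zero_mem _
      | add v w hv hw => rw [map_add]; exact add_mem hv hw
      | single x c =>
        rw [← mul_one c, ← smul_eq_mul, ← Finsupp.smul_single, map_zsmul]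
        refine Submodule.smul_mem _ _ ?_
        rcases hpow n x with h | ⟨y, h⟩
        · rw [h]; exact zero_mem _
        · rw [h]; exact Finsupp.single_mem_supported ℤ 1 ⟨x, h⟩
    · intro v hv
      change v ∈ Finsupp.supported ℤ ℤ (I n) at hv
      rw [Finsupp.supported_eq_span_single] at hv
      induction hv using Submodule.span_induction with
      | mem v hv =>
        obtain ⟨y, ⟨x, hx⟩, rfl⟩ := hv
        exact ⟨_, trivial, hx⟩
      | zero => exact zero_mem _
      | add v w _ _ hv hw => exact add_mem hv hw
      | smul c v _ hv => exact zsmul_mem hv c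
  have hfin (n : ℕ) : Module.finrank ℤ (AddSubgroup.map (L ^ n) ⊤) = (I n).ncard := by
    rw [hmap]
    have := Fintype.ofFinite (I n)
    have h : Module.finrank ℤ (Finsupp.supported ℤ ℤ (I n)) = (I n).ncard := by
      rw [(Finsupp.supportedEquivFinsupp (I n)).finrank_eq, Module.finrank_finsupp_self,
        ← Nat.card_eq_fintype_card, Nat.card_coe_set_eq]
    exact h
  have hsub : I (t + 1) ⊆ I t := by
    rintro y ⟨x, hx⟩
    rw [pow_succ, AddMonoid.End.coe_mul, Function.comp_apply] at hx
    rcases hL x with h | ⟨z, h⟩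
    · rw [h, map_zero] at hx
      exact absurd hx.symm (by simp)
    · exact ⟨z, h ▸ hx⟩
  have heq : I (t + 1) = I t :=
    Set.eq_of_subset_of_ncard_le hsub (by rw [← hfin, ← hfin, hrank])
  have : y ∈ I (t + 1) := heq ▸ ⟨x, hxy⟩
  exact this

theorem IsNakayamaRing.exists_closure_addGenerators_eq_top (hA : IsNakayamaRing A) :
    ∃ M : ModuleCat.{0} A, Module.Finite A M ∧
      AddSubgroup.closure (addGenerators A M) = ⊤ := by
  have := hA.finite_indecIso
  obtain ⟨n, ⟨e⟩⟩ := Finite.exists_equiv_fin (IndecIso A)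
  have hfin (i : Fin n) : Module.Finite A (e.symm i).out.1 := (e.symm i).out.2.1
  refine ⟨ModuleCat.of A (∀ i : Fin n, (e.symm i).out.1),
    inferInstanceAs (Module.Finite A (∀ i : Fin n, (e.symm i).out.1)), ?_⟩
  rw [eq_top_iff]
  rintro v -
  induction v using Finsupp.induction_linear with
  | zero => exact zero_mem _
  | add v w hv hw => exact add_mem hv hw
  | single x c =>
    rw [← mul_one c, ← smul_eq_mul, ← Finsupp.smul_single]
    refine zsmul_mem (AddSubgroup.subset_closure ?_) c
    obtain ⟨i, rfl⟩ := e.symm.surjective x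
    refine ⟨(e.symm i).out.1, (e.symm i).out.2, ?_, ?_⟩
    · exact isDirectSummandOf_of_leftInverse
        (M := ModuleCat.of A (∀ i : Fin n, (e.symm i).out.1))
        (σ := LinearMap.single A (fun i => (e.symm i).out.1) i)
        (π := LinearMap.proj i) fun x => by simp
    · exact congrArg (Finsupp.single · 1) (Quotient.out_eq (e.symm i)).symm

/-- The delooping level of a simple module over a Nakayama ring is at most the `φ`-dimension. -/
theorem IsNakayamaRing.delMod_le_phiDim (hA : IsNakayamaRing A) (S : ModuleCat.{0} A)
    (hS : IsSimpleModule A S) : delMod A S ≤ phiDim A := by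
  obtain ⟨M, hM, htop⟩ := hA.exists_closure_addGenerators_eq_top
  refine le_trans ?_ (le_sSup ⟨M, hM, rfl⟩ : phiMod A M ≤ phiDim A)
  refine le_sInf ?_
  rintro _ ⟨t, ht, rfl⟩
  refine sInf_le ⟨t, ?_, rfl⟩
  have hrank := ht 1 le_rfl
  rw [htop] at hrank
  have hfin := hA.finite_indecIso
  have hL (x : IndecIso A) : syzygyEnd A (Finsupp.single x 1) = 0 ∨
      ∃ y, syzygyEnd A (Finsupp.single x 1) = Finsupp.single y 1 := by
    induction x using Quotient.inductionOn with
    | h X =>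
      obtain ⟨N, -, ⟨-, h⟩ | ⟨hN, h⟩⟩ := hA.exists_isNthSyzygyOf X 1
      · exact Or.inl (by simpa using h)
      · exact Or.inr ⟨_, by simpa using h⟩
  obtain ⟨N, hNS, ⟨hsub, -⟩ | ⟨hN, hNL⟩⟩ :=
    hA.exists_isNthSyzygyOf ⟨S, indecomposableModule_of_isSimpleModule hS⟩ t
  · obtain ⟨N', hN', -⟩ :=
      hA.exists_isNthSyzygyOf ⟨S, indecomposableModule_of_isSimpleModule hS⟩ (t + 1)
    exact ⟨S, N, N', inferInstance, hNS, hN', isDirectSummandOf_of_leftInverse (σ := 0) (π := 0)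
      fun _ => Subsingleton.elim _ _⟩
  · obtain ⟨z, hz⟩ :=
      exists_pow_succ_single_eq_of_finrank_range_eq (syzygyEnd A) hL t hrank hNL
    induction z using Quotient.inductionOn with
    | h X =>
      obtain ⟨N', hN', ⟨-, h⟩ | ⟨hind, h⟩⟩ := hA.exists_isNthSyzygyOf X (t + 1)
      · rw [h] at hz
        exact absurd hz.symm (by simp)
      · rw [h] at hz
        obtain ⟨e⟩ : Nonempty (N' ≃ₗ[A] N) :=
          Quotient.exact (Finsupp.single_left_injective one_ne_zero hz)
        exact ⟨X.1, N, N', X.2.1, hNS, hN', ModuleCat.of A A,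
          ⟨(LinearEquiv.prodComm A A N').trans (e.prodCongr (LinearEquiv.refl A A))⟩⟩

end SyzygyLemmas

/-- For a cyclic Nakayama algebra `Λ`, the delooping level is bounded
above by the `φ`-dimension: `del Λ ≤ φdim Λ`. -/
theorem del_le_phiDim
    (A : Type) [Ring A] (hA : IsCyclicNakayama A) :
    delAlg A ≤ phiDim A := by
  refine sSup_le ?_
  rintro _ ⟨S, hS, rfl⟩
  exact hA.1.1.delMod_le_phiDim S hS

end
end

section
/- Let Λ be a cyclic Nakayama algebra with φdim Λ = 2. Then findim Λ = 1 if and only if del Λ = 1. -/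
open Function DirectSum
open scoped Classical

noncomputable section

section UniserialModules

variable {A : Type} [Ring A]

/-- The submodules of `M` form a chain. -/
def HasSubmoduleChain (A : Type) [Ring A] (M : Type) [AddCommGroup M] [Module A M] : Prop :=
  ∀ N N' : Submodule A M, N ≤ N' ∨ N' ≤ N

/-- `M` is the quotient of a projective module by a projective submodule. -/
def PdLeOne (A : Type) [Ring A] (M : Type) [AddCommGroup M] [Module A M] : Prop :=
  ∃ (P : ModuleCat.{0} A) (f : ↥P →ₗ[A] M), Module.Projective A ↥P ∧ Surjective f ∧
    Module.Projective A ↥(LinearMap.ker f)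

/-- `M` is isomorphic to a submodule of the regular module. -/
def EmbedsInRegular (A : Type) [Ring A] (M : Type) [AddCommGroup M] [Module A M] : Prop :=
  ∃ f : M →ₗ[A] A, Injective f

/-- A nonzero finitely generated uniserial projective module. -/
structure IsUniserialProjective (A : Type) [Ring A] (P : Type) [AddCommGroup P] [Module A P] :
    Prop where
  projective : Module.Projective A P
  finite : Module.Finite A P
  nontrivial : Nontrivial P
  chain : HasSubmoduleChain A P

variable {M N U Y P S T : Type} [AddCommGroup M] [Module A M] [AddCommGroup N] [Module A N]
  [AddCommGroup U] [Module A U] [AddCommGroup Y] [Module A Y] [AddCommGroup P] [Module A P]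
  [AddCommGroup S] [Module A S] [AddCommGroup T] [Module A T]

theorem HasSubmoduleChain.of_injective (hM : HasSubmoduleChain A M) (f : N →ₗ[A] M)
    (hf : Injective f) : HasSubmoduleChain A N := fun K L => by
  have hc := Submodule.comap_map_eq_of_injective hf
  rcases hM (K.map f) (L.map f) with h | h
  · left; have := Submodule.comap_mono (f := f) h; rwa [hc, hc] at this
  · right; have := Submodule.comap_mono (f := f) h; rwa [hc, hc] at this

theorem HasSubmoduleChain.isSmall (hM : HasSubmoduleChain A M) {K : Submodule A M}
    (hK : K ≠ ⊤) : IsSmallSubmodule A K := fun L hL => by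
  rcases hM K L with h | h
  · rwa [sup_eq_right.2 h] at hL
  · exact absurd (by rwa [sup_eq_left.2 h] at hL) hK

theorem HasSubmoduleChain.le_of_isCoatom (hM : HasSubmoduleChain A M) {K L : Submodule A M}
    (hK : IsCoatom K) (hL : L ≠ ⊤) : L ≤ K := by
  rcases hM L K with h | h
  · exact h
  · rcases eq_or_lt_of_le h with h | h
    · exact h.ge
    · exact absurd (hK.2 _ h) hL

theorem HasSubmoduleChain.isAtom_le (hM : HasSubmoduleChain A M) {K L : Submodule A M}
    (hK : IsAtom K) (hL : L ≠ ⊥) : K ≤ L := by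
  rcases hM K L with h | h
  · exact h
  · rcases eq_or_lt_of_le h with h | h
    · exact h.ge
    · exact absurd (hK.2 _ h) hL

/-- A map which does not kill an element of a minimal submodule of a uniserial module is
injective. -/
theorem HasSubmoduleChain.injective_of_isAtom (hM : HasSubmoduleChain A M) {K : Submodule A M}
    (hK : IsAtom K) {x : M} (hx : x ∈ K) {f : M →ₗ[A] N} (hfx : f x ≠ 0) : Injective f := by
  rw [← LinearMap.ker_eq_bot]
  by_contra h
  exact hfx (hM.isAtom_le hK h hx)

theorem ker_ne_top_of_surjective [Nontrivial N] {f : M →ₗ[A] N} (hf : Surjective f) :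
    LinearMap.ker f ≠ ⊤ := by
  intro h
  rw [LinearMap.ker_eq_top] at h
  obtain ⟨y, hy⟩ := exists_ne (0 : N)
  obtain ⟨x, rfl⟩ := hf y
  exact hy (by simp [h])

/-- A map whose composite with a surjection with small kernel is surjective is surjective. -/
theorem surjective_of_isSmall_ker {f : M →ₗ[A] N} (hs : IsSmallSubmodule A (LinearMap.ker f))
    {g : P →ₗ[A] M} (hg : Surjective (f ∘ₗ g)) : Surjective g := by
  rw [← LinearMap.range_eq_top]
  apply hs
  rw [eq_top_iff]
  intro x _
  obtain ⟨y, hy⟩ := hg (f x)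
  rw [← sub_add_cancel x (g y)]
  refine Submodule.add_mem_sup ?_ ⟨y, rfl⟩
  simpa [sub_eq_zero] using hy.symm

/-- Schanuel's lemma for a retract. -/
theorem projective_ker_of_retract {Q : Type} [AddCommGroup Q] [Module A Q]
    [Module.Projective A P] [Module.Projective A Q] (i : N →ₗ[A] M) (r : M →ₗ[A] N)
    (hri : ∀ x, r (i x) = x) (f : P →ₗ[A] M) (hf : Surjective f) (g : Q →ₗ[A] N)
    (hg : Surjective g) [Module.Projective A ↥(LinearMap.ker f)] :
    Module.Projective A ↥(LinearMap.ker g) := by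
  obtain ⟨a, ha⟩ := Module.projective_lifting_property f (i ∘ₗ g) hf
  obtain ⟨b, hb⟩ := Module.projective_lifting_property g (r ∘ₗ f) hg
  have ha' : ∀ x, f (a x) = i (g x) := fun x => LinearMap.congr_fun ha x
  have hb' : ∀ x, g (b x) = r (f x) := fun x => LinearMap.congr_fun hb x
  let s : ↥(LinearMap.ker g) →ₗ[A] ↥(LinearMap.ker f) × Q :=
    LinearMap.prod (a.restrict (fun x hx => by
      simp only [LinearMap.mem_ker] at hx ⊢; simp [ha', hx])) (LinearMap.ker g).subtype
  let p : ↥(LinearMap.ker f) × Q →ₗ[A] ↥(LinearMap.ker g) :=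
    LinearMap.coprod (b.restrict (fun x hx => by
      simp only [LinearMap.mem_ker] at hx ⊢; simp [hb', hx]))
      ((LinearMap.id - b ∘ₗ a).codRestrict (LinearMap.ker g) (fun x => by
        simp [ha', hb', hri]))
  refine Module.Projective.of_split s p ?_
  ext x
  simp [s, p]

theorem PdLeOne.projective_ker (h : PdLeOne A M) [Module.Projective A P] (f : P →ₗ[A] M)
    (hf : Surjective f) : Module.Projective A ↥(LinearMap.ker f) := by
  obtain ⟨Q, g, _, hg, _⟩ := h
  exact projective_ker_of_retract LinearMap.id LinearMap.id (fun _ => rfl) g hg f hf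

theorem pdLeOne_of_projective_ker [Module.Projective A P] (f : P →ₗ[A] M)
    (hf : Surjective f) (hk : Module.Projective A ↥(LinearMap.ker f)) : PdLeOne A M :=
  ⟨ModuleCat.of A P, f, ‹_›, hf, hk⟩

theorem PdLeOne.congr (h : PdLeOne A M) (e : M ≃ₗ[A] N) : PdLeOne A N := by
  obtain ⟨Q, g, _, hg, _⟩ := h
  refine ⟨Q, e.toLinearMap ∘ₗ g, ‹_›, e.surjective.comp hg, ?_⟩
  rwa [LinearEquiv.ker_comp]

theorem pdLeOne_of_projective [Module.Projective A M] : PdLeOne A M := by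
  refine pdLeOne_of_projective_ker (LinearMap.id : M →ₗ[A] M) surjective_id ?_
  rw [LinearMap.ker_id]
  infer_instance

theorem EmbedsInRegular.of_injective (h : EmbedsInRegular A M) (f : N →ₗ[A] M)
    (hf : Injective f) : EmbedsInRegular A N := by
  obtain ⟨g, hg⟩ := h
  exact ⟨g ∘ₗ f, hg.comp hf⟩

/-- A simple module mapping nontrivially to a projective module embeds in the regular module. -/
theorem embedsInRegular_of_ne_zero [IsSimpleModule A S] [Module.Projective A P]
    (f : S →ₗ[A] P) (hf : f ≠ 0) : EmbedsInRegular A S := by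
  obtain ⟨s, hs⟩ := Module.projective_def'.1 ‹Module.Projective A P›
  obtain ⟨x, hx⟩ : ∃ x, f x ≠ 0 := by
    by_contra! h
    exact hf (LinearMap.ext h)
  have hsx : s (f x) ≠ 0 := fun h => hx (by
    have := LinearMap.congr_fun hs (f x)
    simpa [h] using this.symm)
  obtain ⟨p, hp⟩ := Finsupp.ne_iff.1 hsx
  refine ⟨Finsupp.lapply p ∘ₗ s ∘ₗ f, LinearMap.injective_of_ne_zero fun h => hp ?_⟩
  simpa using LinearMap.congr_fun h x

theorem embedsInRegular_of_injective [IsSimpleModule A S] [Module.Projective A P]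
    (f : S →ₗ[A] P) (hf : Injective f) : EmbedsInRegular A S := by
  refine embedsInRegular_of_ne_zero f fun h => ?_
  have := IsSimpleModule.nontrivial A S
  obtain ⟨x, hx⟩ := exists_ne (0 : S)
  exact hx (hf (by simp [h]))

theorem exists_isCoatom_submodule [Module.Finite A M] [Nontrivial M] :
    ∃ K : Submodule A M, IsCoatom K := by
  obtain ⟨K, hK, -⟩ := (eq_top_or_exists_le_coatom (⊥ : Submodule A M)).resolve_left bot_ne_top
  exact ⟨K, hK⟩

theorem projective_of_equiv_pi [Module.Projective A M] {ι : Type} {X : ι → ModuleCat.{0} A}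
    (e : M ≃ₗ[A] ∀ k, ↥(X k)) (k : ι) : Module.Projective A ↥(X k) := by
  refine Module.Projective.of_split (e.symm.toLinearMap ∘ₗ LinearMap.single A (fun k => ↥(X k)) k)
    (LinearMap.proj k ∘ₗ e.toLinearMap) ?_
  ext x
  simp

theorem exists_surjective_of_equiv_pi [IsSimpleModule A S] {ι : Type} [Fintype ι]
    {X : ι → ModuleCat.{0} A} (e : A ≃ₗ[A] ∀ k, ↥(X k)) :
    ∃ (k : ι) (f : ↥(X k) →ₗ[A] S), Surjective f := by
  have := IsSimpleModule.nontrivial A S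
  obtain ⟨x, hx⟩ := exists_ne (0 : S)
  let g := LinearMap.toSpanSingleton A S x ∘ₗ e.symm.toLinearMap
  obtain ⟨k, hk⟩ : ∃ k, g ∘ₗ LinearMap.single A (fun k => ↥(X k)) k ≠ 0 := by
    by_contra! h
    have hg : g = 0 := LinearMap.pi_ext' fun k => by simpa using h k
    apply hx
    simpa [g] using LinearMap.congr_fun hg (e 1)
  exact ⟨k, _, LinearMap.surjective_of_ne_zero hk⟩

theorem isAtom_range [IsSimpleModule A T] (i : T →ₗ[A] U) (hi : Injective i) :
    IsAtom (LinearMap.range i) := by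
  rw [← isSimpleModule_iff_isAtom]
  exact IsSimpleModule.congr (LinearEquiv.ofInjective i hi).symm

/-- A projective cover of a module admitting a surjection from a uniserial projective module
embeds in that module. -/
theorem IsUniserialProjective.exists_injective_of_surjective (hP : IsUniserialProjective A P)
    {Q : Type} [AddCommGroup Q] [Module A Q] [Module.Projective A Q] {f : P →ₗ[A] M}
    (hf : Surjective f) {g : Q →ₗ[A] M} (hg : Surjective g)
    (hs : IsSmallSubmodule A (LinearMap.ker g)) : ∃ u : Q →ₗ[A] P, Injective u := by
  have := hP.projective
  obtain ⟨a, ha⟩ := Module.projective_lifting_property g f hg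
  have hsur : Surjective a := surjective_of_isSmall_ker hs (by rwa [ha])
  obtain ⟨b, hb⟩ := Module.projective_lifting_property a LinearMap.id hsur
  exact ⟨b, fun x y hxy => by
    rw [← LinearMap.id_apply (R := A) x, ← LinearMap.id_apply (R := A) y, ← hb]
    simp [hxy]⟩

theorem exists_comp_eq_of_range_le {Z : Type} [AddCommGroup Z] [Module A Z] {α : U →ₗ[A] Z}
    {β : Y →ₗ[A] Z} (hβ : Injective β) (hle : LinearMap.range α ≤ LinearMap.range β) :
    ∃ u : U →ₗ[A] Y, ∀ x, β (u x) = α x := by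
  refine ⟨(LinearEquiv.ofInjective β hβ).symm.toLinearMap ∘ₗ
    α.codRestrict _ (fun x => hle ⟨x, rfl⟩), fun x => ?_⟩
  rw [LinearMap.comp_apply, LinearEquiv.coe_coe, ← LinearEquiv.ofInjective_apply (h := hβ),
    LinearEquiv.apply_symm_apply]
  rfl

/-- Every module of finite length is a finite product of indecomposable modules. -/
theorem exists_equiv_pi_indecomposable [IsArtinian A M] [IsNoetherian A M] :
    ∃ (ι : Type) (_ : Fintype ι) (X : ι → ModuleCat.{0} A),
      (∀ k, Module.Finite A ↥(X k) ∧ IndecomposableModule A (X k)) ∧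
        Nonempty (M ≃ₗ[A] ∀ k, ↥(X k)) := by
  suffices h : ∀ N : Submodule A M, ∃ (ι : Type) (_ : Fintype ι) (X : ι → ModuleCat.{0} A),
      (∀ k, Module.Finite A ↥(X k) ∧ IndecomposableModule A (X k)) ∧
        Nonempty (↥N ≃ₗ[A] ∀ k, ↥(X k)) by
    obtain ⟨ι, hι, X, hX, ⟨e⟩⟩ := h ⊤
    exact ⟨ι, hι, X, hX, ⟨Submodule.topEquiv.symm.trans e⟩⟩
  intro N
  induction N using WellFoundedLT.induction with
  | ind N ih =>
    by_cases hN : Nontrivial ↥N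
    swap
    · rw [not_nontrivial_iff_subsingleton] at hN
      exact ⟨PEmpty, inferInstance, fun k => k.elim, fun k => k.elim,
        ⟨⟨0, 0, fun x => Subsingleton.elim _ _, fun x => Subsingleton.elim _ _⟩⟩⟩
    by_cases hi : IndecomposableModule A (ModuleCat.of A ↥N)
    · exact ⟨Unit, inferInstance, fun _ => ModuleCat.of A ↥N,
        fun _ => ⟨inferInstanceAs (Module.Finite A ↥N), hi⟩,
        ⟨(LinearEquiv.funUnique Unit A ↥N).symm⟩⟩
    have hi' : ∃ K L : Submodule A ↥N, IsCompl K L ∧ K ≠ ⊥ ∧ K ≠ ⊤ := by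
      by_contra! h
      exact hi ⟨hN, fun K L hKL => or_iff_not_imp_left.2 (h K L hKL)⟩
    obtain ⟨K, L, hKL, hK, hK'⟩ := hi'
    have hL : L ≠ ⊤ := fun h => hK (by have := hKL.disjoint; rwa [h, disjoint_top] at this)
    have hlt : ∀ K : Submodule A ↥N, K ≠ ⊤ → K.map N.subtype < N := fun K hK => by
      refine lt_of_le_of_ne (Submodule.map_subtype_le _ _) fun h => hK ?_
      rw [eq_top_iff]
      intro x _
      have hx : (x : M) ∈ K.map N.subtype := h.symm ▸ x.2
      obtain ⟨y, hy, hyx⟩ := hx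
      rwa [← Subtype.ext hyx]
    obtain ⟨ι₁, _, X₁, hX₁, ⟨e₁⟩⟩ := ih _ (hlt K hK')
    obtain ⟨ι₂, _, X₂, hX₂, ⟨e₂⟩⟩ := ih _ (hlt L hL)
    refine ⟨ι₁ ⊕ ι₂, inferInstance, Sum.elim X₁ X₂, by
      rintro (k | k)
      exacts [hX₁ k, hX₂ k], ⟨?_⟩⟩
    exact (Submodule.prodEquivOfIsCompl K L hKL).symm.trans
      ((((Submodule.equivSubtypeMap N K).trans e₁).prodCongr
        ((Submodule.equivSubtypeMap N L).trans e₂)).trans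
        (LinearEquiv.sumPiEquivProdPi A ι₁ ι₂ (fun k => ↥(Sum.elim X₁ X₂ k))).symm)

end UniserialModules

section NakayamaRings

variable {A : Type} [Ring A] [IsArtinianRing A]

variable {M N U Y P S T : Type} [AddCommGroup M] [Module A M] [AddCommGroup N] [Module A N]
  [AddCommGroup U] [Module A U] [AddCommGroup Y] [Module A Y] [AddCommGroup P] [Module A P]
  [AddCommGroup S] [Module A S] [AddCommGroup T] [Module A T]

theorem exists_isSimpleModule_submodule [Module.Finite A M] [Nontrivial M] :
    ∃ K : Submodule A M, IsAtom K ∧ IsSimpleModule A ↥K := by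
  obtain ⟨K, hK, -⟩ := (eq_bot_or_exists_atom_le (⊤ : Submodule A M)).resolve_left top_ne_bot
  exact ⟨K, hK, isSimpleModule_iff_isAtom.2 hK⟩

theorem exists_equiv_pi_uniserial (hA : IsNakayamaRing A) [Module.Finite A M] :
    ∃ (ι : Type) (_ : Fintype ι) (X : ι → ModuleCat.{0} A),
      (∀ k, Module.Finite A ↥(X k) ∧ Nontrivial ↥(X k) ∧ HasSubmoduleChain A ↥(X k)) ∧
        Nonempty (M ≃ₗ[A] ∀ k, ↥(X k)) := by
  obtain ⟨ι, hι, X, hX, e⟩ := exists_equiv_pi_indecomposable (A := A) (M := M)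
  exact ⟨ι, hι, X, fun k => ⟨(hX k).1, (hX k).2.1, hA.2 _ (hX k).1 (hX k).2⟩, e⟩

theorem exists_uniserialProjective_surjective_simple (hA : IsNakayamaRing A)
    [IsSimpleModule A S] :
    ∃ (Q : ModuleCat.{0} A) (f : ↥Q →ₗ[A] S), IsUniserialProjective A ↥Q ∧ Surjective f := by
  obtain ⟨ι, _, X, hX, ⟨e⟩⟩ := exists_equiv_pi_uniserial hA (M := A)
  obtain ⟨k, f, hf⟩ := exists_surjective_of_equiv_pi (S := S) e
  exact ⟨X k, f, ⟨projective_of_equiv_pi e k, (hX k).1, (hX k).2.1, (hX k).2.2⟩, hf⟩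

theorem exists_uniserialProjective_surjective (hA : IsNakayamaRing A) [Module.Finite A Y]
    [Nontrivial Y] (hY : HasSubmoduleChain A Y) :
    ∃ (Q : ModuleCat.{0} A) (f : ↥Q →ₗ[A] Y), IsUniserialProjective A ↥Q ∧ Surjective f := by
  obtain ⟨K, hK⟩ := exists_isCoatom_submodule (A := A) (M := Y)
  have := isSimpleModule_iff_isCoatom.2 hK
  obtain ⟨Q, f, hQ, hf⟩ := exists_uniserialProjective_surjective_simple hA (S := Y ⧸ K)
  have := hQ.projective
  obtain ⟨g, hg⟩ := Module.projective_lifting_property K.mkQ f K.mkQ_surjective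
  refine ⟨Q, g, hQ, surjective_of_isSmall_ker (f := K.mkQ) ?_ (by rwa [hg])⟩
  rw [Submodule.ker_mkQ]
  exact hY.isSmall hK.1

/-- A uniserial module with a nonzero projective submodule is projective. -/
theorem projective_of_injective (hA : IsNakayamaRing A) [Module.Finite A Y]
    (hY : HasSubmoduleChain A Y) [Nontrivial P] [Module.Projective A P] (j : P →ₗ[A] Y)
    (hj : Injective j) : Module.Projective A Y := by
  have := hj.nontrivial
  obtain ⟨Q, f, hQ, hf⟩ := exists_uniserialProjective_surjective hA hY
  have := hQ.projective
  obtain ⟨g, hg⟩ := Module.projective_lifting_property f j hf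
  have hg' : ∀ x, f (g x) = j x := fun x => LinearMap.congr_fun hg x
  have hker : LinearMap.ker f = ⊥ := by
    rcases hQ.chain (LinearMap.range g) (LinearMap.ker f) with h | h
    · obtain ⟨x, hx⟩ := exists_ne (0 : P)
      have : f (g x) = 0 := h ⟨x, rfl⟩
      exact absurd (hj (by simpa [hg'] using this)) hx
    · rw [eq_bot_iff]
      intro y hy
      obtain ⟨x, rfl⟩ := h hy
      have : j x = 0 := by rw [← hg']; exact hy
      have hx : x = 0 := hj (by simpa using this)
      simp [hx]
  exact Module.Projective.of_equiv' (LinearEquiv.ofBijective f ⟨LinearMap.ker_eq_bot.1 hker, hf⟩)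

/-- Amalgamation of two modules into a uniserial module, not killing a given element. -/
theorem exists_uniserial_amalgam (hA : IsNakayamaRing A) [Module.Finite A U] [Module.Finite A Y]
    (i : N →ₗ[A] U) (hi : Injective i) (h : N →ₗ[A] Y) {y : Y} (hy : y ≠ 0) :
    ∃ (Z : ModuleCat.{0} A) (α : U →ₗ[A] ↥Z) (β : Y →ₗ[A] ↥Z), HasSubmoduleChain A ↥Z ∧
      (∀ n, α (i n) = β (h n)) ∧ β y ≠ 0 := by
  let R : Submodule A (U × Y) := LinearMap.range (i.prod (-h))
  obtain ⟨ι, _, X, hX, ⟨e⟩⟩ := exists_equiv_pi_uniserial hA (M := (U × Y) ⧸ R)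
  have hy0 : R.mkQ (0, y) ≠ 0 := by
    rw [Ne, Submodule.mkQ_apply, Submodule.Quotient.mk_eq_zero]
    rintro ⟨n, hn⟩
    have h1 : i n = 0 := congrArg Prod.fst hn
    have h2 : -h n = y := congrArg Prod.snd hn
    have hn0 : n = 0 := hi (by simpa using h1)
    exact hy (by rw [← h2, hn0]; simp)
  obtain ⟨k, hk⟩ := Function.ne_iff.1 (e.map_ne_zero_iff.2 hy0)
  let q : U × Y →ₗ[A] ↥(X k) := LinearMap.proj k ∘ₗ e.toLinearMap ∘ₗ R.mkQ
  refine ⟨X k, q ∘ₗ LinearMap.inl A U Y, q ∘ₗ LinearMap.inr A U Y, (hX k).2.2, fun n => ?_, hk⟩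
  rw [← sub_eq_zero]
  have hn : R.mkQ (i n, -h n) = 0 := by
    rw [Submodule.mkQ_apply, Submodule.Quotient.mk_eq_zero]
    exact ⟨n, rfl⟩
  have : q (i n, -h n) = 0 := by simp only [q, LinearMap.comp_apply, hn, map_zero]
  change q (i n, 0) - q (0, h n) = 0
  rw [← map_sub]
  simpa using this

/-- A non-surjective map from the maximal submodule of a uniserial module to a uniserial module
extends to the whole module. -/
theorem exists_extension_of_isCoatom (hA : IsNakayamaRing A) [Module.Finite A U]
    [Module.Finite A Y] (hY : HasSubmoduleChain A Y)
    {K : Submodule A U} (hK : IsCoatom K) (h : ↥K →ₗ[A] Y) (hns : ¬ Surjective h) :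
    ∃ u : U →ₗ[A] Y, ∀ n : ↥K, u n = h n := by
  cases subsingleton_or_nontrivial Y with
  | inl _ => exact ⟨0, fun _ => Subsingleton.elim _ _⟩
  | inr _ =>
    obtain ⟨L, hL, _⟩ := exists_isSimpleModule_submodule (A := A) (M := Y)
    obtain ⟨y, hyL, hy⟩ := L.ne_bot_iff.1 hL.1
    obtain ⟨Z, α, β, hZ, hαβ, hβ⟩ :=
      exists_uniserial_amalgam hA K.subtype K.subtype_injective h hy
    have hβi : Injective β := hY.injective_of_isAtom hL hyL hβ
    have hle : LinearMap.range α ≤ LinearMap.range β := by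
      rcases hZ (LinearMap.range α) (LinearMap.range β) with hle | hle
      · exact hle
      have hKL : K ≤ (LinearMap.range β).comap α := fun n hn => ⟨h ⟨n, hn⟩, (hαβ ⟨n, hn⟩).symm⟩
      rcases eq_or_lt_of_le hKL with heq | hlt
      · refine absurd (fun y => ?_) hns
        obtain ⟨x, hx⟩ := hle ⟨y, rfl⟩
        have hxK : x ∈ K := by rw [heq]; exact ⟨y, hx.symm⟩
        exact ⟨⟨x, hxK⟩, hβi (by rw [← hαβ, ← hx]; rfl)⟩
      · rintro _ ⟨x, rfl⟩
        have : x ∈ (LinearMap.range β).comap α := by rw [hK.2 _ hlt]; trivial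
        exact this
    obtain ⟨u, hu⟩ := exists_comp_eq_of_range_le hβi hle
    exact ⟨u, fun n => hβi ((hu n).trans (hαβ n))⟩

/-- Of two uniserial modules with the same socle, one embeds in the other. -/
theorem exists_injective_of_common_socle (hA : IsNakayamaRing A) [Module.Finite A U]
    [Module.Finite A Y] (hU : HasSubmoduleChain A U) (hY : HasSubmoduleChain A Y)
    [IsSimpleModule A T] (i : T →ₗ[A] U) (hi : Injective i) (h : T →ₗ[A] Y) (hh : Injective h) :
    (∃ u : U →ₗ[A] Y, Injective u) ∨ ∃ v : Y →ₗ[A] U, Injective v := by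
  have := IsSimpleModule.nontrivial A T
  obtain ⟨t, ht⟩ := exists_ne (0 : T)
  obtain ⟨Z, α, β, hZ, hαβ, hβ⟩ :=
    exists_uniserial_amalgam hA i hi h ((map_ne_zero_iff h hh).2 ht)
  have hβi : Injective β := hY.injective_of_isAtom (isAtom_range h hh) ⟨t, rfl⟩ hβ
  have hαi : Injective α :=
    hU.injective_of_isAtom (isAtom_range i hi) ⟨t, rfl⟩ (by rwa [hαβ])
  rcases hZ (LinearMap.range α) (LinearMap.range β) with hle | hle
  · obtain ⟨u, hu⟩ := exists_comp_eq_of_range_le hβi hle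
    exact .inl ⟨u, fun x y hxy => hαi (by rw [← hu, ← hu, hxy])⟩
  · obtain ⟨v, hv⟩ := exists_comp_eq_of_range_le hαi hle
    exact .inr ⟨v, fun x y hxy => hβi (by rw [← hv, ← hv, hxy])⟩

/-- A finitely generated nonprojective module of projective dimension one has a simple submodule
of projective dimension at most one. -/
theorem exists_simple_submodule_pdLeOne (hA : IsNakayamaRing A) [Module.Finite A M]
    (hM : ¬ Module.Projective A M) (hpd : PdLeOne A M) :
    ∃ (X : ModuleCat.{0} A) (i : ↥X →ₗ[A] M), IsSimpleModule A ↥X ∧ Injective i ∧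
      PdLeOne A ↥X := by
  obtain ⟨ι, _, X, hX, ⟨e⟩⟩ := exists_equiv_pi_uniserial hA (M := M)
  obtain ⟨k, hk⟩ : ∃ k, ¬ Module.Projective A ↥(X k) := by
    by_contra! h
    exact hM (Module.Projective.of_equiv'
      ((DirectSum.linearEquivFunOnFintype A ι fun k => ↥(X k)).trans e.symm))
  obtain ⟨_, _, hchain⟩ := hX k
  obtain ⟨Q, g, hQ, hg⟩ := exists_uniserialProjective_surjective hA hchain
  obtain ⟨Q', g', _, hg', _⟩ := hpd
  have := hQ.projective
  have := hQ.finite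
  have hker : Module.Projective A ↥(LinearMap.ker g) :=
    projective_ker_of_retract (e.symm.toLinearMap ∘ₗ LinearMap.single A (fun k => ↥(X k)) k)
      (LinearMap.proj k ∘ₗ e.toLinearMap) (fun x => by simp) g' hg' g hg
  have hnt : Nontrivial ↥(LinearMap.ker g) := by
    rw [Submodule.nontrivial_iff_ne_bot]
    intro h
    exact hk (Module.Projective.of_equiv'
      (LinearEquiv.ofBijective g ⟨LinearMap.ker_eq_bot.1 h, hg⟩))
  obtain ⟨L, hL, hLs⟩ := exists_isSimpleModule_submodule (A := A) (M := ↥(X k))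
  let V : Submodule A ↥Q := L.comap g
  have hle : LinearMap.ker g ≤ V := fun x hx => by
    change g x ∈ L
    rw [LinearMap.mem_ker.1 hx]
    exact L.zero_mem
  have : Module.Projective A ↥V :=
    projective_of_injective hA (hQ.chain.of_injective V.subtype V.subtype_injective)
      (Submodule.inclusion hle) (Submodule.inclusion_injective hle)
  let gV : ↥V →ₗ[A] ↥L := g.restrict fun x hx => hx
  have hgV : Surjective gV := fun y => by
    obtain ⟨x, hx⟩ := hg y
    exact ⟨⟨x, by change g x ∈ L; rw [hx]; exact y.2⟩, Subtype.ext hx⟩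
  refine ⟨ModuleCat.of A ↥L, e.symm.toLinearMap ∘ₗ LinearMap.single A (fun k => ↥(X k)) k ∘ₗ
    L.subtype, hLs, e.symm.injective.comp ((Pi.single_injective k).comp L.subtype_injective),
    pdLeOne_of_projective_ker gV hgV ?_⟩
  refine Module.Projective.of_equiv' (LinearEquiv.ofBijective
    ((Submodule.inclusion hle).codRestrict (LinearMap.ker gV) fun x => ?_) ⟨?_, ?_⟩)
  · exact Subtype.ext x.2
  · intro x y hxy
    exact Submodule.inclusion_injective hle (congrArg Subtype.val hxy)
  · rintro ⟨x, hx⟩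
    exact ⟨⟨x.1, congrArg Subtype.val hx⟩, rfl⟩

end NakayamaRings

section SimpleModules

variable {A : Type} [Ring A]

/-- Isomorphism as a setoid on simple modules. -/
def simpleSetoid (A : Type) [Ring A] : Setoid {S : ModuleCat.{0} A // IsSimpleModule A ↥S} where
  r X Y := Nonempty (↥X.1 ≃ₗ[A] ↥Y.1)
  iseqv := ⟨fun _ => ⟨LinearEquiv.refl A _⟩, fun ⟨e⟩ => ⟨e.symm⟩, fun ⟨e⟩ ⟨e'⟩ => ⟨e.trans e'⟩⟩

/-- Isomorphism classes of simple modules. -/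
abbrev SimpleIso (A : Type) [Ring A] := Quotient (simpleSetoid A)

theorem SimpleIso.eq_of_equiv {q r : SimpleIso A} (e : ↥q.out.1 ≃ₗ[A] ↥r.out.1) : q = r := by
  rw [← q.out_eq, ← r.out_eq]
  exact Quotient.sound ⟨e⟩

theorem SimpleIso.exists_out_equiv (S : ModuleCat.{0} A) (hS : IsSimpleModule A ↥S) :
    ∃ q : SimpleIso A, Nonempty (↥q.out.1 ≃ₗ[A] ↥S) :=
  ⟨Quotient.mk (simpleSetoid A) ⟨S, hS⟩, Quotient.mk_out (s := simpleSetoid A) ⟨S, hS⟩⟩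

variable {M N U Y P S T : Type} [AddCommGroup M] [Module A M] [AddCommGroup N] [Module A N]
  [AddCommGroup U] [Module A U] [AddCommGroup Y] [Module A Y] [AddCommGroup P] [Module A P]
  [AddCommGroup S] [Module A S] [AddCommGroup T] [Module A T]

/-- A uniserial module has at most one simple quotient. -/
theorem HasSubmoduleChain.nonempty_equiv_of_surjective (hM : HasSubmoduleChain A M)
    [IsSimpleModule A S] [IsSimpleModule A T] {f : M →ₗ[A] S} (hf : Surjective f)
    {g : M →ₗ[A] T} (hg : Surjective g) : Nonempty (S ≃ₗ[A] T) := by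
  have hf' := LinearMap.isCoatom_ker_of_surjective hf
  have hg' := LinearMap.isCoatom_ker_of_surjective hg
  have h : LinearMap.ker f = LinearMap.ker g :=
    le_antisymm (hM.le_of_isCoatom hg' hf'.1) (hM.le_of_isCoatom hf' hg'.1)
  exact ⟨(f.quotKerEquivOfSurjective hf).symm.trans
    ((Submodule.quotEquivOfEq _ _ h).trans (g.quotKerEquivOfSurjective hg))⟩

/-- A uniserial module has at most one simple submodule. -/
theorem HasSubmoduleChain.nonempty_equiv_of_injective (hM : HasSubmoduleChain A M)
    [IsSimpleModule A S] [IsSimpleModule A T] {f : S →ₗ[A] M} (hf : Injective f)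
    {g : T →ₗ[A] M} (hg : Injective g) : Nonempty (S ≃ₗ[A] T) := by
  have hf' := isAtom_range f hf
  have hg' := isAtom_range g hg
  have h : LinearMap.range f = LinearMap.range g :=
    le_antisymm (hM.isAtom_le hf' hg'.1) (hM.isAtom_le hg' hf'.1)
  exact ⟨(LinearEquiv.ofInjective f hf).trans
    ((LinearEquiv.ofEq _ _ h).trans (LinearEquiv.ofInjective g hg).symm)⟩

theorem SimpleIso.finite [IsArtinianRing A] (hA : IsNakayamaRing A) : Finite (SimpleIso A) := by
  obtain ⟨ι, _, X, hX, ⟨e⟩⟩ := exists_equiv_pi_uniserial hA (M := A)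
  have h : ∀ k, ∃ K : Submodule A ↥(X k), IsCoatom K := fun k =>
    have := (hX k).1
    have := (hX k).2.1
    exists_isCoatom_submodule
  choose K hK using h
  have hs : ∀ k, IsSimpleModule A (↥(X k) ⧸ K k) := fun k => isSimpleModule_iff_isCoatom.2 (hK k)
  refine Finite.of_surjective (α := ι)
    (fun k => Quotient.mk (simpleSetoid A) ⟨ModuleCat.of A (↥(X k) ⧸ K k), hs k⟩) fun q => ?_
  have := q.out.2
  obtain ⟨k, f, hf⟩ := exists_surjective_of_equiv_pi (S := ↥q.out.1) e
  have := hs k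
  refine ⟨k, ?_⟩
  rw [← q.out_eq]
  exact Quotient.sound ((hX k).2.2.nonempty_equiv_of_surjective (K k).mkQ_surjective hf)

/-- `T` is the socle and `S` the top of a uniserial projective module. -/
def IsSocleOfCover (A : Type) [Ring A] (S T : Type) [AddCommGroup S] [Module A S]
    [AddCommGroup T] [Module A T] : Prop :=
  ∃ Q : ModuleCat.{0} A, IsUniserialProjective A ↥Q ∧
    (∃ f : ↥Q →ₗ[A] S, Surjective f) ∧ ∃ g : T →ₗ[A] ↥Q, Injective g

theorem IsSocleOfCover.equiv_right {S T T' : Type} [AddCommGroup S] [Module A S]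
    [AddCommGroup T] [Module A T] [AddCommGroup T'] [Module A T'] [IsSimpleModule A S]
    [IsSimpleModule A T] [IsSimpleModule A T'] (h : IsSocleOfCover A S T)
    (h' : IsSocleOfCover A S T') : Nonempty (T ≃ₗ[A] T') := by
  obtain ⟨Q, hQ, ⟨f, hf⟩, g, hg⟩ := h
  obtain ⟨Q', hQ', ⟨f', hf'⟩, g', hg'⟩ := h'
  have := hQ.projective
  have := IsSimpleModule.nontrivial A S
  obtain ⟨u, hu⟩ := hQ'.exists_injective_of_surjective hf' hf
    (hQ.chain.isSmall (ker_ne_top_of_surjective hf))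
  exact hQ'.chain.nonempty_equiv_of_injective (f := u ∘ₗ g) (hu.comp hg) hg'

variable [IsArtinianRing A]

/-- If a uniserial projective module embeds in another one, whose top has projective dimension at
least two, then both have the same top. -/
theorem nonempty_equiv_of_injective_of_not_pdLeOne (hA : IsNakayamaRing A)
    [IsSimpleModule A S] [IsSimpleModule A T] {Q : Type} [AddCommGroup Q] [Module A Q]
    (hP : IsUniserialProjective A P) (hQ : IsUniserialProjective A Q) {f : P →ₗ[A] S}
    (hf : Surjective f) {g : Q →ₗ[A] T} (hg : Surjective g) (hT : ¬ PdLeOne A T)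
    {u : P →ₗ[A] Q} (hu : Injective u) : Nonempty (S ≃ₗ[A] T) := by
  have := hP.projective
  have := hQ.projective
  have := hQ.finite
  have := hP.nontrivial
  by_cases hs : Surjective u
  · exact hP.chain.nonempty_equiv_of_surjective hf (g := g ∘ₗ u) (hg.comp hs)
  · have hle : LinearMap.range u ≤ LinearMap.ker g :=
      hQ.chain.le_of_isCoatom (LinearMap.isCoatom_ker_of_surjective hg)
        fun h => hs (LinearMap.range_eq_top.1 h)
    refine absurd (pdLeOne_of_projective_ker g hg ?_) hT
    exact projective_of_injective hA
      (hQ.chain.of_injective _ (LinearMap.ker g).subtype_injective)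
      (u.codRestrict (LinearMap.ker g) fun x => hle ⟨x, rfl⟩)
      fun x y hxy => hu (congrArg Subtype.val hxy)

theorem IsSocleOfCover.equiv_left (hA : IsNakayamaRing A) {S S' T : Type} [AddCommGroup S]
    [Module A S] [AddCommGroup S'] [Module A S'] [AddCommGroup T] [Module A T]
    [IsSimpleModule A S] [IsSimpleModule A S'] [IsSimpleModule A T]
    (hS : ¬ PdLeOne A S) (hS' : ¬ PdLeOne A S') (h : IsSocleOfCover A S T)
    (h' : IsSocleOfCover A S' T) : Nonempty (S ≃ₗ[A] S') := by
  obtain ⟨Q, hQ, ⟨f, hf⟩, g, hg⟩ := h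
  obtain ⟨Q', hQ', ⟨f', hf'⟩, g', hg'⟩ := h'
  have := hQ.finite
  have := hQ'.finite
  rcases exists_injective_of_common_socle hA hQ.chain hQ'.chain g hg g' hg' with ⟨u, hu⟩ | ⟨u, hu⟩
  · exact nonempty_equiv_of_injective_of_not_pdLeOne hA hQ hQ' hf hf' hS' hu
  · exact (nonempty_equiv_of_injective_of_not_pdLeOne hA hQ' hQ hf' hf hS hu).map
      LinearEquiv.symm

theorem exists_isSocleOfCover_of_simple (hA : IsNakayamaRing A) [IsSimpleModule A S] :
    ∃ X : ModuleCat.{0} A, IsSimpleModule A ↥X ∧ EmbedsInRegular A ↥X ∧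
      IsSocleOfCover A S ↥X := by
  obtain ⟨Q, f, hQ, hf⟩ := exists_uniserialProjective_surjective_simple hA (S := S)
  have := hQ.projective
  have := hQ.finite
  have := hQ.nontrivial
  obtain ⟨L, -, hL⟩ := exists_isSimpleModule_submodule (A := A) (M := ↥Q)
  exact ⟨ModuleCat.of A ↥L, hL, embedsInRegular_of_injective L.subtype L.subtype_injective,
    Q, hQ, ⟨f, hf⟩, L.subtype, L.subtype_injective⟩

/-- A nonprojective simple submodule of a projective uniserial module is the socle of a projective
uniserial module whose top has projective dimension at least two. -/
theorem exists_isSocleOfCover_of_embedsInRegular (hA : IsNakayamaRing A) [IsSimpleModule A T]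
    (hns : ∀ X : ModuleCat.{0} A, IsSimpleModule A ↥X → ¬ Module.Projective A ↥X)
    (hT : EmbedsInRegular A T) :
    ∃ X : ModuleCat.{0} A, IsSimpleModule A ↥X ∧ ¬ PdLeOne A ↥X ∧ IsSocleOfCover A ↥X T := by
  obtain ⟨j, hj⟩ := hT
  obtain ⟨ι, _, X, hX, ⟨e⟩⟩ := exists_equiv_pi_uniserial hA (M := A)
  have := IsSimpleModule.nontrivial A T
  obtain ⟨t, ht⟩ := exists_ne (0 : T)
  obtain ⟨k, hk⟩ := Function.ne_iff.1 (e.map_ne_zero_iff.2 ((map_ne_zero_iff j hj).2 ht))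
  have := projective_of_equiv_pi e k
  obtain ⟨_, _, hchain⟩ := hX k
  let i : T →ₗ[A] ↥(X k) := LinearMap.proj k ∘ₗ e.toLinearMap ∘ₗ j
  have hi : Injective i := LinearMap.injective_of_ne_zero fun h =>
    hk (LinearMap.congr_fun h t)
  obtain ⟨V, ⟨hVp, hVi⟩, hmin⟩ := WellFounded.has_min (wellFounded_lt (α := Submodule A ↥(X k)))
    {V | Module.Projective A ↥V ∧ LinearMap.range i ≤ V}
    ⟨⊤, Module.Projective.of_equiv' Submodule.topEquiv.symm, le_top⟩
  let iV : T →ₗ[A] ↥V := i.codRestrict V fun x => hVi ⟨x, rfl⟩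
  have hiV : Injective iV := fun x y hxy => hi (congrArg Subtype.val hxy)
  have hVt : Nontrivial ↥V := hiV.nontrivial
  have hVc : HasSubmoduleChain A ↥V := hchain.of_injective _ V.subtype_injective
  obtain ⟨K, hK⟩ := exists_isCoatom_submodule (A := A) (M := ↥V)
  refine ⟨ModuleCat.of A (↥V ⧸ K), isSimpleModule_iff_isCoatom.2 hK, fun hpd => ?_,
    ModuleCat.of A ↥V, ⟨hVp, inferInstanceAs (Module.Finite A ↥V), hVt, hVc⟩,
    ⟨K.mkQ, K.mkQ_surjective⟩, iV, hiV⟩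
  have hKp : Module.Projective A ↥K := by
    have := hpd.projective_ker K.mkQ K.mkQ_surjective
    rwa [Submodule.ker_mkQ] at this
  have hat := isAtom_range iV hiV
  have hne : LinearMap.range iV ≠ ⊤ := fun h => by
    have : Module.Projective A T := Module.Projective.of_equiv'
      (LinearEquiv.ofBijective iV ⟨hiV, LinearMap.range_eq_top.1 h⟩).symm
    exact hns (ModuleCat.of A T) ‹_› this
  have hle := hVc.le_of_isCoatom hK hne
  refine hmin (K.map V.subtype) ⟨Module.Projective.of_equiv' (Submodule.equivSubtypeMap V K), ?_⟩
    ?_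
  · rintro _ ⟨x, rfl⟩
    exact ⟨iV x, hle ⟨x, rfl⟩, rfl⟩
  · refine lt_of_le_of_ne (Submodule.map_subtype_le _ _) fun h => hK.1 ?_
    rw [eq_top_iff]
    intro x _
    have hx : (x : ↥(X k)) ∈ K.map V.subtype := h.symm ▸ x.2
    obtain ⟨y, hy, hyx⟩ := hx
    rwa [← Subtype.ext hyx]

/-- The simple modules of projective dimension at least two are equinumerous with the simple
submodules of the regular module. -/
theorem ncard_not_pdLeOne_eq_ncard_embedsInRegular (hA : IsNakayamaRing A)
    (hns : ∀ X : ModuleCat.{0} A, IsSimpleModule A ↥X → ¬ Module.Projective A ↥X) :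
    {q : SimpleIso A | ¬ PdLeOne A ↥q.out.1}.ncard =
      {q : SimpleIso A | EmbedsInRegular A ↥q.out.1}.ncard := by
  have hsimple : ∀ q : SimpleIso A, IsSimpleModule A ↥q.out.1 := fun q => q.out.2
  have hsoc : ∀ q : SimpleIso A, ∃ r : SimpleIso A, EmbedsInRegular A ↥r.out.1 ∧
      IsSocleOfCover A ↥q.out.1 ↥r.out.1 := fun q => by
    obtain ⟨X, hX, hemb, Q, hQ, hf, g, hg⟩ := exists_isSocleOfCover_of_simple hA (S := ↥q.out.1)
    obtain ⟨r, ⟨e⟩⟩ := SimpleIso.exists_out_equiv X hX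
    exact ⟨r, hemb.of_injective e.toLinearMap e.injective, Q, hQ, hf, g ∘ₗ e.toLinearMap,
      hg.comp e.injective⟩
  choose soc hemb hsoc using hsoc
  refine Set.ncard_congr (fun q _ => soc q) (fun q _ => hemb q) (fun q r hq hr h => ?_)
    fun r hr => ?_
  · have hr' := hsoc r
    rw [← h] at hr'
    exact SimpleIso.eq_of_equiv (IsSocleOfCover.equiv_left hA hq hr (hsoc q) hr').some
  · obtain ⟨X, hX, hpd, Q, hQ, ⟨f, hf⟩, hg⟩ :=
      exists_isSocleOfCover_of_embedsInRegular hA (T := ↥r.out.1) hns hr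
    obtain ⟨q, ⟨e⟩⟩ := SimpleIso.exists_out_equiv X hX
    have hqr : IsSocleOfCover A ↥q.out.1 ↥r.out.1 :=
      ⟨Q, hQ, ⟨e.symm.toLinearMap ∘ₗ f, e.symm.surjective.comp hf⟩, hg⟩
    exact ⟨q, fun h => hpd (h.congr e), SimpleIso.eq_of_equiv ((hsoc q).equiv_right hqr).some⟩

theorem forall_not_pdLeOne_iff_forall_embedsInRegular (hA : IsNakayamaRing A)
    (hns : ∀ X : ModuleCat.{0} A, IsSimpleModule A ↥X → ¬ Module.Projective A ↥X) :
    (∀ X : ModuleCat.{0} A, IsSimpleModule A ↥X → ¬ PdLeOne A ↥X) ↔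
      ∀ X : ModuleCat.{0} A, IsSimpleModule A ↥X → EmbedsInRegular A ↥X := by
  have := SimpleIso.finite hA
  have hcard := ncard_not_pdLeOne_eq_ncard_embedsInRegular hA hns
  constructor <;> intro h X hX <;> obtain ⟨q, ⟨e⟩⟩ := SimpleIso.exists_out_equiv X hX
  · have hsub := Set.eq_of_subset_of_ncard_le
      (s := {q : SimpleIso A | EmbedsInRegular A ↥q.out.1})
      (fun r _ => h r.out.1 r.out.2) hcard.le
    have hq : q ∈ {q : SimpleIso A | EmbedsInRegular A ↥q.out.1} := hsub ▸ h q.out.1 q.out.2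
    exact EmbedsInRegular.of_injective hq e.symm.toLinearMap e.symm.injective
  · have hsub := Set.eq_of_subset_of_ncard_le
      (t := {q : SimpleIso A | EmbedsInRegular A ↥q.out.1})
      (s := {q : SimpleIso A | ¬ PdLeOne A ↥q.out.1})
      (fun r _ => h r.out.1 r.out.2) hcard.ge
    have hq : q ∈ {q : SimpleIso A | ¬ PdLeOne A ↥q.out.1} := hsub.symm ▸ h q.out.1 q.out.2
    exact fun hpd => hq (hpd.congr e.symm)

theorem embedsInRegular_imp_not_pdLeOne_iff (hA : IsNakayamaRing A)
    (hns : ∀ X : ModuleCat.{0} A, IsSimpleModule A ↥X → ¬ Module.Projective A ↥X) :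
    (∀ X : ModuleCat.{0} A, IsSimpleModule A ↥X → EmbedsInRegular A ↥X → ¬ PdLeOne A ↥X) ↔
      ∀ X : ModuleCat.{0} A, IsSimpleModule A ↥X → ¬ PdLeOne A ↥X → EmbedsInRegular A ↥X := by
  have := SimpleIso.finite hA
  have hcard := ncard_not_pdLeOne_eq_ncard_embedsInRegular hA hns
  constructor <;> intro h X hX hX' <;> obtain ⟨q, ⟨e⟩⟩ := SimpleIso.exists_out_equiv X hX
  · have hsub := Set.eq_of_subset_of_ncard_le
      (s := {q : SimpleIso A | EmbedsInRegular A ↥q.out.1})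
      (t := {q : SimpleIso A | ¬ PdLeOne A ↥q.out.1})
      (fun r hr => h r.out.1 r.out.2 hr) hcard.le
    have hq : q ∈ {q : SimpleIso A | EmbedsInRegular A ↥q.out.1} :=
      hsub ▸ fun hpd => hX' (hpd.congr e)
    exact EmbedsInRegular.of_injective hq e.symm.toLinearMap e.symm.injective
  · have hsub := Set.eq_of_subset_of_ncard_le
      (t := {q : SimpleIso A | EmbedsInRegular A ↥q.out.1})
      (s := {q : SimpleIso A | ¬ PdLeOne A ↥q.out.1})
      (fun r hr => h r.out.1 r.out.2 hr) hcard.ge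
    have hq : q ∈ {q : SimpleIso A | ¬ PdLeOne A ↥q.out.1} :=
      hsub.symm ▸ EmbedsInRegular.of_injective hX' e.toLinearMap e.injective
    exact fun hpd => hq (hpd.congr e.symm)

end SimpleModules

section HomologicalDimensions

variable {A : Type} [Ring A]

theorem IsSyzygyOf.exists_injective {N M : ModuleCat.{0} A} (h : IsSyzygyOf A N M) :
    ∃ (P : ModuleCat.{0} A) (i : ↥N →ₗ[A] ↥P), Module.Projective A ↥P ∧ Module.Finite A ↥P ∧
      Injective i := by
  obtain ⟨P, f, hP, hfin, -, -, ⟨e⟩⟩ := h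
  exact ⟨P, (LinearMap.ker f).subtype ∘ₗ e.toLinearMap, hP, hfin,
    (LinearMap.ker f).subtype_injective.comp e.injective⟩

theorem IsSyzygyOf.pdLeOne {N M : ModuleCat.{0} A} (h : IsSyzygyOf A N M)
    (hN : Module.Projective A ↥N) : PdLeOne A ↥M := by
  obtain ⟨P, f, hP, -, hf, -, ⟨e⟩⟩ := h
  exact pdLeOne_of_projective_ker f hf (Module.Projective.of_equiv' e)

theorem IsNthSyzygyOf.pdLeOne {n : ℕ} {N M : ModuleCat.{0} A} (hn : n ≤ 1)
    (h : IsNthSyzygyOf A n N M) (hN : Module.Projective A ↥N) : PdLeOne A ↥M := by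
  obtain rfl | rfl : n = 0 ∨ n = 1 := by omega
  · obtain ⟨e⟩ := h
    have := Module.Projective.of_equiv' e
    exact pdLeOne_of_projective
  · obtain ⟨K, ⟨e⟩, hK⟩ := h
    exact (hK.pdLeOne hN).congr e

theorem IsNthSyzygyOf.finite [IsNoetherianRing A] {n : ℕ} {N M : ModuleCat.{0} A}
    (hM : Module.Finite A ↥M) (h : IsNthSyzygyOf A n N M) : Module.Finite A ↥N := by
  cases n with
  | zero =>
    obtain ⟨e⟩ := h
    exact Module.Finite.equiv e.symm
  | succ n =>
    obtain ⟨K, -, hK⟩ := h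
    obtain ⟨P, i, -, _, hi⟩ := hK.exists_injective
    exact Module.Finite.of_injective i hi

theorem projDim_le {n : ℕ} {N M : ModuleCat.{0} A} (h : IsNthSyzygyOf A n N M)
    (hN : Module.Projective A ↥N) : projDim A M ≤ n :=
  sInf_le ⟨n, ⟨N, h, hN⟩, rfl⟩

theorem exists_natCast_eq_sInf_image {s : Set ℕ}
    (h : sInf ((fun n : ℕ => (n : ℕ∞)) '' s) ≠ ⊤) :
    ∃ n ∈ s, (n : ℕ∞) = sInf ((fun n : ℕ => (n : ℕ∞)) '' s) := by
  refine csInf_mem (s := (fun n : ℕ => (n : ℕ∞)) '' s) ?_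
  by_contra hs
  rw [Set.not_nonempty_iff_eq_empty] at hs
  exact h (by rw [hs, sInf_empty])

theorem exists_projective_syzygy_of_finDim_le {k n : ℕ} (hk : finDim A ≤ k) {M N : ModuleCat.{0} A}
    (hM : Module.Finite A ↥M) (h : IsNthSyzygyOf A n N M) (hN : Module.Projective A ↥N) :
    ∃ m ≤ k, ∃ K : ModuleCat.{0} A, IsNthSyzygyOf A m K M ∧ Module.Projective A ↥K := by
  have htop : projDim A M ≠ ⊤ := ne_top_of_le_ne_top (ENat.natCast_ne_top n) (projDim_le h hN)
  have hle : projDim A M ≤ finDim A := by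
    unfold finDim
    exact le_sSup ⟨htop, M, hM, rfl⟩
  obtain ⟨m, hm, hmeq⟩ := exists_natCast_eq_sInf_image htop
  exact ⟨m, by exact_mod_cast hmeq.trans_le (hle.trans hk), hm⟩

/-- If `finDim A` exceeds `k`, some `m`-th syzygy with `k ≤ m` is nonprojective of projective
dimension one. -/
theorem finDim_le_of_forall [IsNoetherianRing A] {k : ℕ}
    (h : ∀ (m : ℕ) (M K : ModuleCat.{0} A), k ≤ m → Module.Finite A ↥K → IsNthSyzygyOf A m K M →
      PdLeOne A ↥K → Module.Projective A ↥K) : finDim A ≤ k := by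
  refine sSup_le ?_
  rintro _ ⟨htop, M, hM, rfl⟩
  obtain ⟨n, ⟨N, hN, hNp⟩, hneq⟩ := exists_natCast_eq_sInf_image htop
  change (n : ℕ∞) = projDim A M at hneq
  by_contra hlt
  rw [← hneq, not_le] at hlt
  have hlt' : k < n := by exact_mod_cast hlt
  obtain ⟨m, rfl⟩ : ∃ m, n = m + 1 := ⟨n - 1, by omega⟩
  obtain ⟨K, hK, hKN⟩ := hN
  have hKp := h m M K (by omega) (hK.finite hM) hK (hKN.pdLeOne hNp)
  have hle : ((m + 1 : ℕ) : ℕ∞) ≤ m := hneq.trans_le (projDim_le hK hKp)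
  have : m + 1 ≤ m := by exact_mod_cast hle
  omega

variable {M P S : Type} [AddCommGroup M] [Module A M] [AddCommGroup P] [Module A P]
  [AddCommGroup S] [Module A S]

theorem isSmallSubmodule_of_not_projective [Module.Projective A P] {K : Submodule A P}
    (hK : IsAtom K) (hKp : ¬ Module.Projective A ↥K) : IsSmallSubmodule A K := fun L hL => by
  by_cases hle : K ≤ L
  · rwa [sup_eq_right.2 hle] at hL
  · have hc : IsCompl K L :=
      ⟨(hK.not_le_iff_disjoint).1 hle, codisjoint_iff.2 hL⟩
    refine absurd (Module.Projective.of_split K.subtype (K.projectionOnto L hc) ?_) hKp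
    ext x
    simp

/-- A nonprojective simple submodule of the regular module is a syzygy. -/
theorem isSyzygyOf_quotient_range {X : ModuleCat.{0} A} (hX : IsSimpleModule A ↥X)
    (hXp : ¬ Module.Projective A ↥X) (j : ↥X →ₗ[A] A) (hj : Injective j) :
    IsSyzygyOf A X (ModuleCat.of A (A ⧸ LinearMap.range j)) := by
  let e := LinearEquiv.ofInjective j hj
  refine ⟨ModuleCat.of A A, (LinearMap.range j).mkQ, inferInstanceAs (Module.Projective A A),
    inferInstanceAs (Module.Finite A A), (LinearMap.range j).mkQ_surjective, ?_,
    ⟨e.trans (LinearEquiv.ofEq _ _ (Submodule.ker_mkQ _).symm)⟩⟩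
  rw [Submodule.ker_mkQ]
  exact isSmallSubmodule_of_not_projective (isAtom_range j hj)
    fun h => hXp (Module.Projective.of_equiv' e.symm)

variable [IsArtinianRing A]

/-- The kernel of the uniserial projective cover of a simple module. -/
theorem exists_isSyzygyOf_simple (hA : IsNakayamaRing A) (X : ModuleCat.{0} A)
    (hX : IsSimpleModule A ↥X) :
    ∃ (Q : ModuleCat.{0} A) (f : ↥Q →ₗ[A] ↥X), IsUniserialProjective A ↥Q ∧ Surjective f ∧
      IsSyzygyOf A (ModuleCat.of A ↥(LinearMap.ker f)) X := by
  obtain ⟨Q, f, hQ, hf⟩ := exists_uniserialProjective_surjective_simple hA (S := ↥X)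
  have := IsSimpleModule.nontrivial A ↥X
  exact ⟨Q, f, hQ, hf, Q, f, hQ.projective, hQ.finite, hf,
    hQ.chain.isSmall (ker_ne_top_of_surjective hf), ⟨LinearEquiv.refl A _⟩⟩

theorem finDim_le_zero_iff (hA : IsNakayamaRing A)
    (hns : ∀ X : ModuleCat.{0} A, IsSimpleModule A ↥X → ¬ Module.Projective A ↥X) :
    finDim A ≤ 0 ↔ ∀ X : ModuleCat.{0} A, IsSimpleModule A ↥X → ¬ PdLeOne A ↥X := by
  constructor
  · intro h X hX hpd
    obtain ⟨Q, f, hQ, hf, hsyz⟩ := exists_isSyzygyOf_simple hA X hX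
    have := hQ.projective
    have hXfin : Module.Finite A ↥X := inferInstance
    obtain ⟨m, hm, K, hK, hKp⟩ := exists_projective_syzygy_of_finDim_le (k := 0) (n := 1)
      (by simpa using h) hXfin ⟨X, ⟨LinearEquiv.refl A _⟩, hsyz⟩ (hpd.projective_ker f hf)
    obtain rfl : m = 0 := by omega
    obtain ⟨e⟩ := hK
    exact hns X hX (Module.Projective.of_equiv' e)
  · intro h
    refine le_of_le_of_eq (finDim_le_of_forall (k := 0) fun m M K _ hK _ hpd => ?_) (by simp)
    by_contra hKp
    obtain ⟨X, i, hX, -, hXpd⟩ := exists_simple_submodule_pdLeOne hA hKp hpd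
    exact h X hX hXpd

theorem finDim_le_one_iff (hA : IsNakayamaRing A)
    (hns : ∀ X : ModuleCat.{0} A, IsSimpleModule A ↥X → ¬ Module.Projective A ↥X) :
    finDim A ≤ 1 ↔
      ∀ X : ModuleCat.{0} A, IsSimpleModule A ↥X → EmbedsInRegular A ↥X → ¬ PdLeOne A ↥X := by
  constructor
  · rintro h X hX ⟨j, hj⟩ hpd
    obtain ⟨Q, f, hQ, hf, hsyz⟩ := exists_isSyzygyOf_simple hA X hX
    have := hQ.projective
    have hfin : Module.Finite A ↥(ModuleCat.of A (A ⧸ LinearMap.range j)) :=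
      inferInstanceAs (Module.Finite A (A ⧸ LinearMap.range j))
    obtain ⟨m, hm, K, hK, hKp⟩ := exists_projective_syzygy_of_finDim_le (k := 1) (n := 2)
      (by simpa using h) hfin ⟨X, ⟨_, ⟨LinearEquiv.refl A _⟩,
        isSyzygyOf_quotient_range hX (hns X hX) j hj⟩, hsyz⟩ (hpd.projective_ker f hf)
    have hker := (hK.pdLeOne hm hKp).projective_ker (P := A) (LinearMap.range j).mkQ
      (LinearMap.range j).mkQ_surjective
    rw [Submodule.ker_mkQ] at hker
    exact hns X hX (Module.Projective.of_equiv' (LinearEquiv.ofInjective j hj).symm)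
  · intro h
    refine le_of_le_of_eq (finDim_le_of_forall (k := 1) fun m M K hm hK hsyz hpd => ?_) (by simp)
    by_contra hKp
    obtain ⟨X, i, hX, hi, hXpd⟩ := exists_simple_submodule_pdLeOne hA hKp hpd
    obtain ⟨n, rfl⟩ : ∃ n, m = n + 1 := ⟨m - 1, by omega⟩
    obtain ⟨L, -, hL⟩ := hsyz
    obtain ⟨P, g, _, -, hg⟩ := hL.exists_injective
    exact h X hX (embedsInRegular_of_injective (g ∘ₗ i) (hg.comp hi)) hXpd

end HomologicalDimensions

section DeloopingLevel

variable {A : Type} [Ring A]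

/-- Some `d`-th syzygy of `M` is a direct summand of `A ⊕ N'`, where `N'` is a `(d + 1)`-st syzygy of a
finitely generated module. -/
def IsDeloopable (d : ℕ) (M : ModuleCat.{0} A) : Prop :=
  ∃ M' N N' : ModuleCat.{0} A, Module.Finite A ↥M' ∧ IsNthSyzygyOf A d N M ∧
    IsNthSyzygyOf A (d + 1) N' M' ∧ IsDirectSummandOf A N (ModuleCat.of A (A × ↥N'))

theorem delAlg_le_iff {k : ℕ} :
    delAlg A ≤ k ↔ ∀ X : ModuleCat.{0} A, IsSimpleModule A ↥X → ∃ d ≤ k, IsDeloopable d X := by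
  constructor
  · intro h X hX
    have hle : delMod A X ≤ k := by
      refine le_trans ?_ h
      unfold delAlg
      exact le_sSup ⟨X, hX, rfl⟩
    obtain ⟨d, hd, hdeq⟩ :=
      exists_natCast_eq_sInf_image (ne_top_of_le_ne_top (ENat.natCast_ne_top k) hle)
    exact ⟨d, by exact_mod_cast hdeq.trans_le hle, hd⟩
  · intro h
    refine sSup_le ?_
    rintro _ ⟨X, hX, rfl⟩
    obtain ⟨d, hd, hdX⟩ := h X hX
    exact le_trans (sInf_le ⟨d, hdX, rfl⟩) (Nat.cast_le.2 hd)

theorem isDeloopable_zero_iff {X : ModuleCat.{0} A} (hX : IsSimpleModule A ↥X)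
    (hXp : ¬ Module.Projective A ↥X) : IsDeloopable 0 X ↔ EmbedsInRegular A ↥X := by
  constructor
  · rintro ⟨M', N, N', -, ⟨e⟩, ⟨K, -, hK⟩, C, ⟨s⟩⟩
    obtain ⟨P, i, _, -, hi⟩ := hK.exists_injective
    let g : ↥X →ₗ[A] A × ↥P := (LinearMap.id.prodMap i) ∘ₗ s.symm.toLinearMap ∘ₗ
      LinearMap.inl A ↥N ↥C ∘ₗ e.symm.toLinearMap
    exact embedsInRegular_of_injective g
      ((Prod.map_injective.2 ⟨injective_id, hi⟩).comp (s.symm.injective.comp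
        (LinearMap.inl_injective.comp e.symm.injective)))
  · rintro ⟨j, hj⟩
    refine ⟨ModuleCat.of A (A ⧸ LinearMap.range j), X, X,
      inferInstanceAs (Module.Finite A (A ⧸ LinearMap.range j)), ⟨LinearEquiv.refl A _⟩,
      ⟨_, ⟨LinearEquiv.refl A _⟩, isSyzygyOf_quotient_range hX hXp j hj⟩,
      ModuleCat.of A A, ⟨LinearEquiv.prodComm A A ↥X⟩⟩

theorem delAlg_le_zero_iff
    (hns : ∀ X : ModuleCat.{0} A, IsSimpleModule A ↥X → ¬ Module.Projective A ↥X) :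
    delAlg A ≤ 0 ↔ ∀ X : ModuleCat.{0} A, IsSimpleModule A ↥X → EmbedsInRegular A ↥X := by
  rw [← Nat.cast_zero, delAlg_le_iff]
  refine forall₂_congr fun X hX => ?_
  simp [isDeloopable_zero_iff hX (hns X hX)]

variable {M N P : Type} [AddCommGroup M] [Module A M] [AddCommGroup N] [Module A N]
  [AddCommGroup P] [Module A P]

theorem isDirectSummandOf_of_retract {X Y : ModuleCat.{0} A} (i : ↥X →ₗ[A] ↥Y)
    (r : ↥Y →ₗ[A] ↥X) (h : ∀ x, r (i x) = x) : IsDirectSummandOf A X Y := by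
  have hker : LinearMap.ker (i.rangeRestrict ∘ₗ r) = LinearMap.ker r := by
    ext y
    simp only [LinearMap.mem_ker, LinearMap.comp_apply]
    refine ⟨fun hy => ?_, fun hy => by simp [hy]⟩
    have hiy : i (r y) = 0 := congrArg Subtype.val hy
    rw [← h (r y), hiy, map_zero]
  have hc : IsCompl (LinearMap.range i) (LinearMap.ker r) :=
    hker ▸ LinearMap.isCompl_of_proj (f := i.rangeRestrict ∘ₗ r) (by
      rintro ⟨_, x, rfl⟩
      exact Subtype.ext (by simp [h]))
  have hi : Injective i := Function.LeftInverse.injective h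
  exact ⟨ModuleCat.of A ↥(LinearMap.ker r), ⟨(Submodule.prodEquivOfIsCompl _ _ hc).symm.trans
    ((LinearEquiv.ofInjective i hi).symm.prodCongr (LinearEquiv.refl A _))⟩⟩

theorem isSyzygyOf_zero : IsSyzygyOf A (ModuleCat.of A PUnit) (ModuleCat.of A PUnit) := by
  refine ⟨ModuleCat.of A PUnit, LinearMap.id, inferInstanceAs (Module.Projective A PUnit),
    inferInstanceAs (Module.Finite A PUnit), surjective_id, fun K _ => ?_,
    ⟨⟨0, 0, fun x => ?_, fun x => ?_⟩⟩⟩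
  · exact Subsingleton.elim (α := Submodule A PUnit) _ _
  · exact Subsingleton.elim (α := PUnit) _ _
  · exact Subtype.ext (Subsingleton.elim (α := PUnit) _ _)

variable [IsArtinianRing A]

/-- Uniserial modules have the exchange property of modules with local endomorphism rings. -/
theorem retract_of_retract_prod [Module.Finite A N] [Nontrivial N] (hN : HasSubmoduleChain A N)
    (i : N →ₗ[A] M × P) (r : M × P →ₗ[A] N) (h : ∀ x, r (i x) = x) :
    (∃ (a : N →ₗ[A] M) (b : M →ₗ[A] N), ∀ x, b (a x) = x) ∨
      ∃ (a : N →ₗ[A] P) (b : P →ₗ[A] N), ∀ x, b (a x) = x := by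
  have key : ∀ {L : Type} [AddCommGroup L] [Module A L] (a : N →ₗ[A] L) (b : L →ₗ[A] N),
      Injective (b ∘ₗ a) → ∃ (a : N →ₗ[A] L) (b : L →ₗ[A] N), ∀ x, b (a x) = x := by
    intro L _ _ a b hinj
    let u := LinearEquiv.ofBijective (b ∘ₗ a)
      (IsArtinian.bijective_of_injective_endomorphism _ hinj)
    exact ⟨a, u.symm.toLinearMap ∘ₗ b, fun x => u.symm_apply_apply x⟩
  obtain ⟨L, hL, -⟩ := exists_isSimpleModule_submodule (A := A) (M := N)
  obtain ⟨x, hxL, hx⟩ := L.ne_bot_iff.1 hL.1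
  let a₁ := LinearMap.fst A M P ∘ₗ i
  let a₂ := LinearMap.snd A M P ∘ₗ i
  let b₁ := r ∘ₗ LinearMap.inl A M P
  let b₂ := r ∘ₗ LinearMap.inr A M P
  have hsum : b₁ (a₁ x) + b₂ (a₂ x) = x := by
    change r ((i x).1, 0) + r (0, (i x).2) = x
    rw [← map_add]
    simpa using h x
  by_cases hx₁ : (b₁ ∘ₗ a₁) x = 0
  · refine .inr (key a₂ b₂ (hN.injective_of_isAtom hL hxL ?_))
    intro hx₂
    rw [LinearMap.comp_apply] at hx₁ hx₂
    rw [hx₁, hx₂, add_zero] at hsum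
    exact hx hsum.symm
  · exact .inl (key a₁ b₁ (hN.injective_of_isAtom hL hxL hx₁))

/-- A map from the maximal submodule of a uniserial module into a small submodule of a module
extends to the whole module. -/
theorem exists_extension_of_isSmall (hA : IsNakayamaRing A) [Module.Finite A M]
    [Module.Finite A P] {K : Submodule A M} (hK : IsCoatom K) {L : Submodule A P}
    (hL : IsSmallSubmodule A L) (h : ↥K →ₗ[A] P) (hKL : ∀ x, h x ∈ L) :
    ∃ u : M →ₗ[A] P, ∀ x : ↥K, u x = h x := by
  obtain ⟨ι, _, X, hX, ⟨e⟩⟩ := exists_equiv_pi_uniserial hA (M := P)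
  let π : ∀ k, P →ₗ[A] ↥(X k) := fun k => LinearMap.proj k ∘ₗ e.toLinearMap
  have hext : ∀ k, ∃ u : M →ₗ[A] ↥(X k), ∀ x : ↥K, u x = (π k ∘ₗ h) x := fun k => by
    obtain ⟨_, _, hchain⟩ := hX k
    refine exists_extension_of_isCoatom hA hchain hK _ fun hs => ?_
    have hπ : Surjective (π k) := fun y => (hs y).imp' h fun _ hx => hx
    refine ker_ne_top_of_surjective hπ (hL _ (eq_top_iff.2 fun y _ => ?_))
    obtain ⟨x, hx⟩ := hs (π k y)
    rw [← add_sub_cancel (h x) y]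
    refine Submodule.add_mem_sup (hKL x) ?_
    rw [LinearMap.mem_ker, map_sub, ← hx, LinearMap.comp_apply, sub_self]
  choose u hu using hext
  refine ⟨e.symm.toLinearMap ∘ₗ LinearMap.pi u, fun x => ?_⟩
  rw [LinearMap.comp_apply, LinearEquiv.coe_coe, LinearEquiv.symm_apply_eq]
  ext k
  exact hu k x

theorem isDeloopable_one_of_pdLeOne (hA : IsNakayamaRing A) {X : ModuleCat.{0} A}
    (hX : IsSimpleModule A ↥X) (hXp : ¬ Module.Projective A ↥X) (hpd : PdLeOne A ↥X) :
    IsDeloopable 1 X := by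
  obtain ⟨Q, f, hQ, hf, hsyz⟩ := exists_isSyzygyOf_simple hA X hX
  have := hQ.projective
  have := hQ.finite
  have := hpd.projective_ker f hf
  have hchain := hQ.chain.of_injective _ (LinearMap.ker f).subtype_injective
  have hnt : Nontrivial ↥(LinearMap.ker f) := by
    rw [Submodule.nontrivial_iff_ne_bot]
    intro h
    exact hXp (Module.Projective.of_equiv'
      (LinearEquiv.ofBijective f ⟨LinearMap.ker_eq_bot.1 h, hf⟩))
  obtain ⟨K, hK⟩ := exists_isCoatom_submodule (A := A) (M := ↥(LinearMap.ker f))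
  obtain ⟨x, -, hx⟩ := SetLike.exists_of_lt hK.lt_top
  let g := LinearMap.toSpanSingleton A ↥(LinearMap.ker f) x
  have hg : Surjective g := by
    rw [← LinearMap.range_eq_top]
    by_contra h
    exact hx (hchain.le_of_isCoatom hK h ⟨1, by simp [g]⟩)
  obtain ⟨s, hs⟩ := Module.projective_lifting_property g LinearMap.id hg
  refine ⟨ModuleCat.of A PUnit, _, ModuleCat.of A PUnit,
    inferInstanceAs (Module.Finite A PUnit), ⟨X, ⟨LinearEquiv.refl A _⟩, hsyz⟩,
    ⟨_, ⟨_, ⟨LinearEquiv.refl A _⟩, isSyzygyOf_zero⟩, isSyzygyOf_zero⟩,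
    isDirectSummandOf_of_retract (LinearMap.inl A A PUnit ∘ₗ s) (g ∘ₗ LinearMap.fst A A PUnit)
      fun y => LinearMap.congr_fun hs y⟩

theorem embedsInRegular_of_isDeloopable_one (hA : IsNakayamaRing A) {X : ModuleCat.{0} A}
    (hX : IsSimpleModule A ↥X) (hpd : ¬ PdLeOne A ↥X) (h : IsDeloopable 1 X) :
    EmbedsInRegular A ↥X := by
  obtain ⟨M', N, N', -, ⟨X', ⟨eX⟩, Q, f, hQ, hQfin, hf, hsm, ⟨eN⟩⟩,
    ⟨K, ⟨K', -, hK⟩, P, g, hP, hPfin, hg, hgs, ⟨eN'⟩⟩, C, ⟨s⟩⟩ := h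
  obtain ⟨R, j, hR, -, hj⟩ := hK.exists_injective
  have hX' : IsSimpleModule A ↥X' := IsSimpleModule.congr eX
  obtain ⟨Q₀, f₀, hQ₀, hf₀⟩ := exists_uniserialProjective_surjective_simple hA (S := ↥X')
  obtain ⟨v, hv⟩ := hQ₀.exists_injective_of_surjective hf₀ hf hsm
  have hQc : HasSubmoduleChain A ↥Q := hQ₀.chain.of_injective v hv
  have hkc := hQc.of_injective _ (LinearMap.ker f).subtype_injective
  have hkp : ¬ Module.Projective A ↥(LinearMap.ker f) := fun hp =>
    hpd ((pdLeOne_of_projective_ker f hf hp).congr eX)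
  have hnt : Nontrivial ↥(LinearMap.ker f) := by
    by_contra h
    rw [not_nontrivial_iff_subsingleton] at h
    exact hkp inferInstance
  have hcoatom := LinearMap.isCoatom_ker_of_surjective hf
  rcases retract_of_retract_prod hkc
      (s.symm.toLinearMap ∘ₗ LinearMap.inl A ↥N ↥C ∘ₗ eN.symm.toLinearMap)
      (eN.toLinearMap ∘ₗ LinearMap.fst A ↥N ↥C ∘ₗ s.toLinearMap) (fun x => by simp) with
    ⟨a, b, hab⟩ | ⟨a, b, hab⟩
  · exact absurd (Module.Projective.of_split a b (LinearMap.ext hab)) hkp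
  · obtain ⟨u, hu⟩ := exists_extension_of_isSmall hA hcoatom hgs
      ((LinearMap.ker g).subtype ∘ₗ eN'.toLinearMap ∘ₗ a) fun x => (eN' (a x)).2
    have hne : g ∘ₗ u ≠ 0 := fun h0 => by
      let w : ↥Q →ₗ[A] ↥(LinearMap.ker f) := b ∘ₗ eN'.symm.toLinearMap ∘ₗ
        u.codRestrict (LinearMap.ker g) fun x => LinearMap.congr_fun h0 x
      have hw : ∀ x : ↥(LinearMap.ker f), w x = x := fun x => by
        have : (u.codRestrict (LinearMap.ker g) fun x => LinearMap.congr_fun h0 x) x =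
          eN' (a x) := Subtype.ext (hu x)
        simp [w, this, hab]
      exact hkp (Module.Projective.of_split (LinearMap.ker f).subtype w (LinearMap.ext hw))
    have hle : LinearMap.ker f ≤ LinearMap.ker (g ∘ₗ u) := fun x hx => by
      have := hu ⟨x, hx⟩
      rw [LinearMap.mem_ker, LinearMap.comp_apply, this]
      exact (eN' (a ⟨x, hx⟩)).2
    let t : ↥X →ₗ[A] ↥R := j ∘ₗ (LinearMap.ker f).liftQ (g ∘ₗ u) hle ∘ₗ
      (f.quotKerEquivOfSurjective hf).symm.toLinearMap ∘ₗ eX.symm.toLinearMap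
    refine embedsInRegular_of_ne_zero t fun ht => hne (LinearMap.ext fun x => hj ?_)
    have := LinearMap.congr_fun ht (eX (f x))
    have hfx : (f.quotKerEquivOfSurjective hf).symm (f x) = (LinearMap.ker f).mkQ x := by
      rw [LinearEquiv.symm_apply_eq]
      rfl
    simpa [t, hfx] using this

theorem delAlg_le_one_iff (hA : IsNakayamaRing A)
    (hns : ∀ X : ModuleCat.{0} A, IsSimpleModule A ↥X → ¬ Module.Projective A ↥X) :
    delAlg A ≤ 1 ↔
      ∀ X : ModuleCat.{0} A, IsSimpleModule A ↥X → ¬ PdLeOne A ↥X → EmbedsInRegular A ↥X := by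
  rw [← Nat.cast_one, delAlg_le_iff]
  refine forall₂_congr fun X hX => ⟨?_, fun h => ?_⟩
  · rintro ⟨d, hd, hdX⟩ hpd
    obtain rfl | rfl : d = 0 ∨ d = 1 := by omega
    · exact (isDeloopable_zero_iff hX (hns X hX)).1 hdX
    · exact embedsInRegular_of_isDeloopable_one hA hX hpd hdX
  · by_cases hpd : PdLeOne A ↥X
    · exact ⟨1, le_rfl, isDeloopable_one_of_pdLeOne hA hX (hns X hX) hpd⟩
    · exact ⟨0, zero_le_one, (isDeloopable_zero_iff hX (hns X hX)).2 (h hpd)⟩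

end DeloopingLevel

/-- For a cyclic Nakayama algebra `Λ` with `φdim Λ = 2`:
`findim Λ = 1` iff `del Λ = 1`. -/
theorem findim_one_iff_del_one_of_phiDim_two
    (A : Type) [Ring A] (hA : IsCyclicNakayama A) (hphi : phiDim A = 2) :
    finDim A = 1 ↔ delAlg A = 1 := by
  obtain ⟨⟨hN, -⟩, -, hns⟩ := hA
  have := hN.1
  have hzero : finDim A ≤ 0 ↔ delAlg A ≤ 0 := by
    rw [finDim_le_zero_iff hN hns, delAlg_le_zero_iff hns,
      forall_not_pdLeOne_iff_forall_embedsInRegular hN hns]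
  have hone : finDim A ≤ 1 ↔ delAlg A ≤ 1 := by
    rw [finDim_le_one_iff hN hns, delAlg_le_one_iff hN hns,
      embedsInRegular_imp_not_pdLeOne_iff hN hns]
  have hiff : ∀ d : ℕ∞, d = 1 ↔ d ≤ 1 ∧ ¬ d ≤ 0 := fun d => by
    rw [not_le, ← Order.one_le_iff_pos, ← le_antisymm_iff]
  rw [hiff, hiff, hzero, hone]

end
end
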